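/- arXiv:math/0703808 — 3 statements merged into one kernel-verified Lean document; each statement's English description precedes it below -/
import Mathlib

section
/- Let n ≥ 3 and let a : ℝⁿ \ {0} → [0,∞) be continuous such that for each x ≠ 0, (λ/|z|)⁴ a(x + λ² z/|z|²) < a(x + z) for all 0 < λ < |x| and all z with |z| > λ. If u ∈ C²(ℝⁿ \ {0}) is positive and satisfies Δu(x) + a(x) u(x) + u(x)^{(n+2)/(n−2)} = 0 for all x ∈ ℝⁿ \ {0}, then u is radially symmetric about the origin, and writing u(x) = ū(|x|), one has ū'(r) < 0 for all 0 < r < ∞. -/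
open scoped BigOperators

/-- The Euclidean Laplacian of `u : ℝⁿ → ℝ` at `x`, as the sum of the pure second
derivatives in the standard coordinate directions. -/
noncomputable def eLaplacian {n : ℕ} (u : EuclideanSpace ℝ (Fin n) → ℝ)
    (x : EuclideanSpace ℝ (Fin n)) : ℝ :=
  ∑ i : Fin n, iteratedFDeriv ℝ 2 u x ![EuclideanSpace.single i 1, EuclideanSpace.single i 1]

section SphereInversion

open Filter Topology Set

/-- Second-order differentiability along a line for a `C²` function. -/
theorem hasDerivAt_fderiv_line {E : Type*} [NormedAddCommGroup E] [NormedSpace ℝ E] {f : E → ℝ}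
    {p : E} (hf : ContDiffAt ℝ 2 f p) (e : E) :
    (∀ᶠ t : ℝ in 𝓝 0, HasDerivAt (fun t : ℝ => f (p + t • e)) (fderiv ℝ f (p + t • e) e) t) ∧
      HasDerivAt (fun t : ℝ => fderiv ℝ f (p + t • e) e) (iteratedFDeriv ℝ 2 f p ![e, e]) 0 := by
  have hl : ∀ t : ℝ, HasDerivAt (fun t : ℝ => p + t • e) e t := fun t => by
    simpa using ((hasDerivAt_id t).smul_const e).const_add p
  have hc : ContinuousAt (fun t : ℝ => p + t • e) 0 := (hl 0).continuousAt
  constructor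
  · have h1 : ∀ᶠ y in 𝓝 p, DifferentiableAt ℝ f y :=
      (hf.eventually (by simp)).mono fun y hy => hy.differentiableAt (by simp)
    have h2 : ∀ᶠ t : ℝ in 𝓝 0, DifferentiableAt ℝ f (p + t • e) := by
      apply hc.eventually
      simpa using h1
    filter_upwards [h2] with t ht
    exact ht.hasFDerivAt.comp_hasDerivAt t (hl t)
  · have h0 : ContDiffAt ℝ 1 (fderiv ℝ f) p := hf.fderiv_right (by norm_num)
    have h1 : DifferentiableAt ℝ (fderiv ℝ f) p := h0.differentiableAt (by simp)
    have h2 : HasFDerivAt (fderiv ℝ f) (fderiv ℝ (fderiv ℝ f) p) (p + (0 : ℝ) • e) := by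
      simpa using h1.hasFDerivAt
    have h3 : HasDerivAt (fun t : ℝ => fderiv ℝ f (p + t • e)) (fderiv ℝ (fderiv ℝ f) p e) 0 :=
      h2.comp_hasDerivAt (f := fun t : ℝ => p + t • e) (0 : ℝ) (hl 0)
    simpa [iteratedFDeriv_two_apply] using h3.clm_apply (hasDerivAt_const (0 : ℝ) e)

/-- A second derivative computed along a line equals the corresponding value of the second
Fréchet derivative. -/
theorem iteratedFDeriv_two_eq_of_hasDerivAt {E : Type*} [NormedAddCommGroup E] [NormedSpace ℝ E]
    {f : E → ℝ} {p e : E} (hf : ContDiffAt ℝ 2 f p) {g : ℝ → ℝ} {c : ℝ}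
    (hg : ∀ᶠ t : ℝ in 𝓝 0, HasDerivAt (fun t : ℝ => f (p + t • e)) (g t) t)
    (hc : HasDerivAt g c 0) : iteratedFDeriv ℝ 2 f p ![e, e] = c := by
  obtain ⟨h1, h2⟩ := hasDerivAt_fderiv_line hf e
  refine h2.unique (hc.congr_of_eventuallyEq ?_)
  filter_upwards [h1, hg] with t h3 h4 using h3.unique h4

theorem iteratedFDeriv_two_nonneg_of_isLocalMin {E : Type*} [NormedAddCommGroup E]
    [NormedSpace ℝ E] {f : E → ℝ} {p : E} (hf : ContDiffAt ℝ 2 f p) (hm : IsLocalMin f p) (e : E) :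
    0 ≤ iteratedFDeriv ℝ 2 f p ![e, e] := by
  obtain ⟨h1, h2⟩ := hasDerivAt_fderiv_line hf e
  by_contra! hneg
  set g : ℝ → ℝ := fun t : ℝ => f (p + t • e) with hg
  have hd : deriv g =ᶠ[𝓝 0] fun t : ℝ => fderiv ℝ f (p + t • e) e :=
    h1.mono fun t ht => ht.deriv
  have hcont : ContinuousAt (fun t : ℝ => p + t • e) 0 := by fun_prop
  have hmin : IsLocalMin g 0 := by
    have h3 : ∀ᶠ t : ℝ in 𝓝 0, f p ≤ f (p + t • e) :=
      hcont.eventually (by simpa [IsLocalMin, IsMinFilter] using hm)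
    simpa [IsLocalMin, IsMinFilter, hg] using h3
  have hmax : IsLocalMax g 0 :=
    isLocalMax_of_deriv_deriv_neg (by rwa [hd.deriv_eq, h2.deriv]) hmin.deriv_eq_zero
      h1.self_of_nhds.continuousAt
  have hconst : g =ᶠ[𝓝 0] fun _ => g 0 := by
    filter_upwards [hmin, hmax] with t h3 h4 using le_antisymm h4 h3
  have h5 : deriv g =ᶠ[𝓝 0] fun _ => 0 := by
    simpa using hconst.deriv
  have h6 : deriv (deriv g) 0 = 0 := by simpa using h5.deriv_eq
  rw [hd.deriv_eq, h2.deriv] at h6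
  exact hneg.ne h6

theorem eLaplacian_nonneg_of_isLocalMin {n : ℕ} {f : EuclideanSpace ℝ (Fin n) → ℝ}
    {p : EuclideanSpace ℝ (Fin n)} (hf : ContDiffAt ℝ 2 f p) (hm : IsLocalMin f p) :
    0 ≤ eLaplacian f p :=
  Finset.sum_nonneg fun _ _ => iteratedFDeriv_two_nonneg_of_isLocalMin hf hm _

theorem eLaplacian_sub {n : ℕ} {f g : EuclideanSpace ℝ (Fin n) → ℝ}
    {p : EuclideanSpace ℝ (Fin n)} (hf : ContDiffAt ℝ 2 f p) (hg : ContDiffAt ℝ 2 g p) :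
    eLaplacian (fun y => f y - g y) p = eLaplacian f p - eLaplacian g p := by
  have h : iteratedFDeriv ℝ 2 (fun y => f y - g y) p
      = iteratedFDeriv ℝ 2 f p - iteratedFDeriv ℝ 2 g p :=
    iteratedFDeriv_sub_apply (i := 2) hf hg
  simp [eLaplacian, h, Finset.sum_sub_distrib]

theorem eLaplacian_const_add {n : ℕ} (f : EuclideanSpace ℝ (Fin n) → ℝ) (A : ℝ)
    (p : EuclideanSpace ℝ (Fin n)) : eLaplacian (fun y => A + f y) p = eLaplacian f p := by
  have h : fderiv ℝ (fun y => A + f y) = fderiv ℝ f := by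
    ext1 y; exact fderiv_const_add A
  simp [eLaplacian, iteratedFDeriv_two_apply, h]

theorem eLaplacian_comp_add_left {n : ℕ} (f : EuclideanSpace ℝ (Fin n) → ℝ)
    (x p : EuclideanSpace ℝ (Fin n)) :
    eLaplacian (fun y => f (x + y)) p = eLaplacian f (x + p) := by
  simp [eLaplacian, iteratedFDeriv_comp_add_left]

theorem eLaplacian_const_mul {n : ℕ} {f : EuclideanSpace ℝ (Fin n) → ℝ} (B : ℝ)
    {p : EuclideanSpace ℝ (Fin n)} (hf : ContDiffAt ℝ 2 f p) :
    eLaplacian (fun y => B * f y) p = B * eLaplacian f p := by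
  have h : iteratedFDeriv ℝ 2 (fun y => B * f y) p = B • iteratedFDeriv ℝ 2 f p :=
    iteratedFDeriv_const_smul_apply (a := B) (i := 2) hf
  simp [eLaplacian, h, Finset.mul_sum]

/-- The Kelvin transform (with `n = m + 2`) of `f` in the sphere of radius `l` about `0`. -/
noncomputable def kelvin {n : ℕ} (m : ℕ) (f : EuclideanSpace ℝ (Fin n) → ℝ) (l : ℝ)
    (z : EuclideanSpace ℝ (Fin n)) : ℝ :=
  (l / ‖z‖) ^ m * f ((l ^ 2 / ‖z‖ ^ 2) • z)

theorem contDiffAt_kelvin {n m : ℕ} {f : EuclideanSpace ℝ (Fin n) → ℝ} {l : ℝ}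
    {z : EuclideanSpace ℝ (Fin n)} (hz : z ≠ 0)
    (hf : ContDiffAt ℝ 2 f ((l ^ 2 / ‖z‖ ^ 2) • z)) : ContDiffAt ℝ 2 (kelvin m f l) z := by
  have h1 : ContDiffAt ℝ 2 (fun y : EuclideanSpace ℝ (Fin n) => ‖y‖) z := contDiffAt_norm ℝ hz
  have h0 : ‖z‖ ≠ 0 := norm_ne_zero_iff.2 hz
  refine ((contDiffAt_const.div h1 h0).pow m).mul (ContDiffAt.comp z hf ?_)
  exact (contDiffAt_const.div (h1.pow 2) (pow_ne_zero 2 h0)).smul contDiffAt_id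

/-- The second derivative of a Kelvin transform in the direction `e`. -/
theorem iteratedFDeriv_two_kelvin {n m : ℕ} {f : EuclideanSpace ℝ (Fin n) → ℝ} {l : ℝ}
    {z : EuclideanSpace ℝ (Fin n)} (hz : z ≠ 0)
    (hf : ContDiffAt ℝ 2 f ((l ^ 2 / ‖z‖ ^ 2) • z)) (e : EuclideanSpace ℝ (Fin n)) (c c' s : ℝ)
    (hc : c = inner ℝ z e / ‖z‖ ^ 2) (hc' : c' = ‖e‖ ^ 2 / ‖z‖ ^ 2 - 2 * c ^ 2)
    (hs : s = l ^ 2 / ‖z‖ ^ 2) :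
    iteratedFDeriv ℝ 2 (kelvin m f l) z ![e, e] = (l / ‖z‖) ^ m *
      ((m ^ 2 * c ^ 2 - m * c') * f (s • z)
        - 2 * m * c * fderiv ℝ f (s • z) (s • (e - (2 * c) • z))
        + fderiv ℝ (fderiv ℝ f) (s • z) (s • (e - (2 * c) • z)) (s • (e - (2 * c) • z))
        + fderiv ℝ f (s • z) (s • ((-4 * c) • e + (4 * c ^ 2 - 2 * c') • z))) := by
  set L : ℝ → EuclideanSpace ℝ (Fin n) := fun t => z + t • e with hL
  have hL0 : L 0 = z := by simp [hL]
  have dL : ∀ t, HasDerivAt L e t := fun t => by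
    have h : HasDerivAt L ((1 : ℝ) • e) t := ((hasDerivAt_id t).smul_const e).const_add z
    simpa using h
  have hne : ∀ᶠ t in 𝓝 (0 : ℝ), L t ≠ 0 :=
    (dL 0).continuousAt.eventually_ne (by rwa [hL0])
  set C : ℝ → ℝ := fun t => inner ℝ (L t) e / ‖L t‖ ^ 2 with hC
  set S : ℝ → ℝ := fun t => l ^ 2 / ‖L t‖ ^ 2 with hS
  set P : ℝ → ℝ := fun t => (l / ‖L t‖) ^ m with hP
  have dN : ∀ t, HasDerivAt (fun t => ‖L t‖ ^ 2) (2 * inner ℝ (L t) e) t := fun t =>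
    (dL t).norm_sq
  have dI : ∀ t, HasDerivAt (fun t => inner ℝ (L t) e) (‖e‖ ^ 2) t := fun t => by
    simpa using (dL t).inner ℝ (hasDerivAt_const t e)
  have dR : ∀ t, L t ≠ 0 → HasDerivAt (fun t => ‖L t‖) (inner ℝ (L t) e / ‖L t‖) t := by
    intro t ht
    have h0 : ‖L t‖ ≠ 0 := norm_ne_zero_iff.2 ht
    have h := (dN t).sqrt (pow_ne_zero 2 h0)
    simp only [Real.sqrt_sq (norm_nonneg _)] at h
    convert h using 1
    field_simp
  have dC : ∀ t, L t ≠ 0 → HasDerivAt C (‖e‖ ^ 2 / ‖L t‖ ^ 2 - 2 * C t ^ 2) t := by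
    intro t ht
    have h0 : ‖L t‖ ≠ 0 := norm_ne_zero_iff.2 ht
    refine HasDerivAt.congr_deriv (f := C) ((dI t).div (dN t) (pow_ne_zero 2 h0)) ?_
    simp only [hC]
    field_simp
  have dS : ∀ t, L t ≠ 0 → HasDerivAt S (-2 * S t * C t) t := by
    intro t ht
    have h0 : ‖L t‖ ≠ 0 := norm_ne_zero_iff.2 ht
    refine HasDerivAt.congr_deriv (f := S)
      ((hasDerivAt_const t (l ^ 2)).div (dN t) (pow_ne_zero 2 h0)) ?_
    simp only [hC, hS]
    field_simp
    ring
  have dP : ∀ t, L t ≠ 0 → HasDerivAt P (-m * P t * C t) t := by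
    intro t ht
    have h0 : ‖L t‖ ≠ 0 := norm_ne_zero_iff.2 ht
    refine HasDerivAt.congr_deriv (f := P)
      (((hasDerivAt_const t l).div (dR t ht) h0).pow m) ?_
    simp only [hC, hP]
    rcases m with _ | k
    · simp
    · simp only [Nat.add_sub_cancel, Pi.div_apply, div_pow, pow_succ]
      field_simp
      ring
  set J : ℝ → EuclideanSpace ℝ (Fin n) := fun t => S t • L t with hJ
  set J' : ℝ → EuclideanSpace ℝ (Fin n) := fun t => S t • (e - (2 * C t) • L t) with hJ'
  have dJ : ∀ t, L t ≠ 0 → HasDerivAt J (J' t) t := by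
    intro t ht
    refine HasDerivAt.congr_deriv (f := J) ((dS t ht).smul (dL t)) ?_
    simp only [hJ']
    module
  have dJ' : ∀ t, L t ≠ 0 → HasDerivAt J' (S t • ((-4 * C t) • e +
      (4 * C t ^ 2 - 2 * (‖e‖ ^ 2 / ‖L t‖ ^ 2 - 2 * C t ^ 2)) • L t)) t := by
    intro t ht
    refine HasDerivAt.congr_deriv (f := J') ((dS t ht).smul ((hasDerivAt_const t e).sub
      (((dC t ht).const_mul 2).smul (dL t)))) ?_
    module
  have hL0' : L 0 ≠ 0 := by rwa [hL0]
  have hJ0 : J 0 = (l ^ 2 / ‖z‖ ^ 2) • z := by simp [hJ, hS, hL0]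
  have hf0 : ContDiffAt ℝ 2 f (J 0) := by rwa [hJ0]
  have hdf : ∀ᶠ t in 𝓝 (0 : ℝ), DifferentiableAt ℝ f (J t) :=
    (dJ 0 hL0').continuousAt.eventually
      ((hf0.eventually (by simp)).mono fun y hy => hy.differentiableAt (by simp))
  have hf1 : ContDiffAt ℝ 1 (fderiv ℝ f) (J 0) := hf0.fderiv_right (by norm_num)
  have hf2 : HasFDerivAt (fderiv ℝ f) (fderiv ℝ (fderiv ℝ f) (J 0)) (J 0) :=
    (hf1.differentiableAt (by simp)).hasFDerivAt
  have dA : HasDerivAt (fun t => fderiv ℝ f (J t)) (fderiv ℝ (fderiv ℝ f) (J 0) (J' 0)) 0 :=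
    hf2.comp_hasDerivAt (f := J) 0 (dJ 0 hL0')
  have dU : ∀ᶠ t in 𝓝 (0 : ℝ), HasDerivAt (fun t => f (J t)) (fderiv ℝ f (J t) (J' t)) t := by
    filter_upwards [hdf, hne] with t h1 h2
    exact h1.hasFDerivAt.comp_hasDerivAt (f := J) t (dJ t h2)
  refine iteratedFDeriv_two_eq_of_hasDerivAt (contDiffAt_kelvin hz hf)
    (g := fun t => P t * (-(m * C t * f (J t)) + fderiv ℝ f (J t) (J' t))) ?_ ?_
  · filter_upwards [dU, hne] with t h1 h2
    refine HasDerivAt.congr_deriv (f := kelvin m f l ∘ L) ((dP t h2).mul h1) ?_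
    ring
  · have h := (dP 0 hL0').mul (((((dC 0 hL0').const_mul (m : ℝ)).mul dU.self_of_nhds).neg).add
      (dA.clm_apply (dJ' 0 hL0')))
    refine HasDerivAt.congr_deriv h ?_
    have hC0 : C 0 = c := by simp [hC, hL0, hc]
    have hS0 : S 0 = s := by simp [hS, hL0, hs]
    have hP0 : P 0 = (l / ‖z‖) ^ m := by simp [hP, hL0]
    simp only [Pi.add_apply, Pi.neg_apply, Pi.mul_apply, hJ, hJ', hC0, hS0, hP0, hL0, ← hc']
    ring

theorem sum_coord_mul_map {n : ℕ} (A : EuclideanSpace ℝ (Fin n) →L[ℝ] ℝ)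
    (z : EuclideanSpace ℝ (Fin n)) :
    ∑ i, z i * A (EuclideanSpace.single i 1) = A z := by
  have h : ∑ i, z i • EuclideanSpace.single i (1 : ℝ) = z := by
    simpa using (EuclideanSpace.basisFun (Fin n) ℝ).sum_repr z
  conv_rhs => rw [← h]
  simp

/-- Conformal covariance of the Laplacian under the Kelvin transform. -/
theorem eLaplacian_kelvin {m : ℕ} {f : EuclideanSpace ℝ (Fin (m + 2)) → ℝ} {l : ℝ}
    {z : EuclideanSpace ℝ (Fin (m + 2))} (hz : z ≠ 0)
    (hf : ContDiffAt ℝ 2 f ((l ^ 2 / ‖z‖ ^ 2) • z)) :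
    eLaplacian (kelvin m f l) z =
      (l / ‖z‖) ^ (m + 4) * eLaplacian f ((l ^ 2 / ‖z‖ ^ 2) • z) := by
  have h0 : ‖z‖ ≠ 0 := norm_ne_zero_iff.2 hz
  set s : ℝ := l ^ 2 / ‖z‖ ^ 2 with hs
  set A := fderiv ℝ f (s • z) with hA
  set H := fderiv ℝ (fderiv ℝ f) (s • z) with hH
  set e : Fin (m + 2) → EuclideanSpace ℝ (Fin (m + 2)) := fun i => EuclideanSpace.single i 1
  set ρ : ℝ := ‖z‖ ^ 2 with hρ
  have hρ0 : ρ ≠ 0 := pow_ne_zero 2 h0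
  have hin : ∀ i, inner ℝ z (e i) = z i := fun i => by
    simp [e, EuclideanSpace.inner_single_right]
  have hne : ∀ i, ‖e i‖ ^ 2 = 1 := fun i => by simp [e]
  have hz2 : ∑ i, z i * z i = ρ := by
    rw [hρ, EuclideanSpace.norm_sq_eq]
    simp [pow_two]
  have hAz : ∑ i, z i * A (e i) = A z := sum_coord_mul_map A z
  have hHz : ∑ i, z i * H (e i) z = H z z := sum_coord_mul_map (H.flip z) z
  have hzH : ∑ i, z i * H z (e i) = H z z := sum_coord_mul_map (H z) z
  have key : ∀ i, iteratedFDeriv ℝ 2 (kelvin m f l) z ![e i, e i] = (l / ‖z‖) ^ m *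
      (((m ^ 2 + 2 * m) * f (s • z) + (4 * m * s + 8 * s) * A z + 4 * s ^ 2 * H z z) / ρ ^ 2 *
          (z i * z i) - (m * f (s • z) + 2 * s * A z) / ρ
        - (2 * m * s + 4 * s) / ρ * (z i * A (e i)) - 2 * s ^ 2 / ρ * (z i * H (e i) z)
        - 2 * s ^ 2 / ρ * (z i * H z (e i)) + s ^ 2 * H (e i) (e i)) := by
    intro i
    rw [iteratedFDeriv_two_kelvin hz hf (e i) (z i / ρ) (1 / ρ - 2 * (z i / ρ) ^ 2) s
      (by rw [hin]) (by rw [hne]) rfl]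
    simp only [← hA, ← hH, map_smul, map_sub, map_add, smul_eq_mul, smul_apply,
      sub_apply]
    field_simp
    ring
  have hlap : eLaplacian f (s • z) = ∑ i, H (e i) (e i) := by
    simp [eLaplacian, iteratedFDeriv_two_apply, hH, e]
  have hl : (l / ‖z‖) ^ (m + 4) = (l / ‖z‖) ^ m * s ^ 2 := by
    rw [hs, hρ, pow_add, div_pow l ‖z‖ 4]
    field_simp
  have hsum : eLaplacian (kelvin m f l) z = ∑ i, _ := Finset.sum_congr rfl fun i _ => key i
  rw [hsum, hlap, hl, ← Finset.mul_sum, mul_assoc ((l / ‖z‖) ^ m)]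
  congr 1
  simp only [Finset.sum_add_distrib, Finset.sum_sub_distrib, ← Finset.mul_sum, hz2, hAz, hHz, hzH,
    Finset.sum_const, Finset.card_univ, Fintype.card_fin, nsmul_eq_mul]
  push_cast
  field_simp
  ring

theorem eLaplacian_const_add_inv_norm_pow {m : ℕ} (A B : ℝ) {z : EuclideanSpace ℝ (Fin (m + 2))}
    (hz : z ≠ 0) :
    ContDiffAt ℝ 2 (fun y : EuclideanSpace ℝ (Fin (m + 2)) => A + B * (1 / ‖y‖) ^ m) z ∧
      eLaplacian (fun y : EuclideanSpace ℝ (Fin (m + 2)) => A + B * (1 / ‖y‖) ^ m) z = 0 := by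
  have hk : (fun y : EuclideanSpace ℝ (Fin (m + 2)) => (1 / ‖y‖) ^ m)
      = kelvin m (fun _ => 1) 1 := by
    ext y; simp [kelvin]
  have h1 : ContDiffAt ℝ 2 (fun y : EuclideanSpace ℝ (Fin (m + 2)) => (1 / ‖y‖) ^ m) z := by
    rw [hk]; exact contDiffAt_kelvin hz contDiffAt_const
  refine ⟨contDiffAt_const.add (contDiffAt_const.mul h1), ?_⟩
  rw [eLaplacian_const_add, eLaplacian_const_mul _ h1, hk, eLaplacian_kelvin hz contDiffAt_const]
  simp [eLaplacian, iteratedFDeriv_two_apply]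

/-- Comparison of a strictly superharmonic function with a radial harmonic function
on an annulus. -/
theorem annulus_comparison {m : ℕ} {R₁ R₂ : ℝ} (hR : 0 < R₁)
    {w : EuclideanSpace ℝ (Fin (m + 2)) → ℝ}
    (hc : ContinuousOn w {z | R₁ ≤ ‖z‖ ∧ ‖z‖ ≤ R₂})
    (hw : ∀ z, R₁ < ‖z‖ → ‖z‖ < R₂ → ContDiffAt ℝ 2 w z ∧ eLaplacian w z < 0) {A B : ℝ}
    (h₁ : ∀ z, ‖z‖ = R₁ → A + B * (1 / R₁) ^ m ≤ w z)
    (h₂ : ∀ z, ‖z‖ = R₂ → A + B * (1 / R₂) ^ m ≤ w z)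
    {z : EuclideanSpace ℝ (Fin (m + 2))} (hz₁ : R₁ ≤ ‖z‖) (hz₂ : ‖z‖ ≤ R₂) :
    A + B * (1 / ‖z‖) ^ m ≤ w z := by
  set K : Set (EuclideanSpace ℝ (Fin (m + 2))) := {z | R₁ ≤ ‖z‖ ∧ ‖z‖ ≤ R₂} with hK
  have hKc : IsCompact K := by
    refine (isCompact_closedBall 0 R₂).of_isClosed_subset ?_ fun y hy => by simpa using hy.2
    exact (isClosed_le continuous_const continuous_norm).inter
      (isClosed_le continuous_norm continuous_const)
  have hne : ∀ y ∈ K, ‖y‖ ≠ 0 := fun y hy => (hR.trans_le hy.1).ne'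
  set h : EuclideanSpace ℝ (Fin (m + 2)) → ℝ := fun y => A + B * (1 / ‖y‖) ^ m with hh
  have hhc : ContinuousOn h K := continuousOn_const.add (continuousOn_const.mul
    ((continuousOn_const.div continuous_norm.continuousOn hne).pow m))
  obtain ⟨p, hpK, hp⟩ := hKc.exists_isMinOn ⟨z, hz₁, hz₂⟩ (hc.sub hhc)
  have hpz : w p - h p ≤ w z - h z := hp ⟨hz₁, hz₂⟩
  suffices 0 ≤ w p - h p from sub_nonneg.1 (this.trans hpz)
  by_contra! hneg
  have hp₁ : R₁ < ‖p‖ := lt_of_le_of_ne hpK.1 fun he => by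
    have := h₁ p he.symm
    simp only [hh, ← he] at hneg
    linarith
  have hp₂ : ‖p‖ < R₂ := lt_of_le_of_ne hpK.2 fun he => by
    have := h₂ p he
    simp only [hh, he] at hneg
    linarith
  have hnb : K ∈ 𝓝 p := by
    have ho : IsOpen {y : EuclideanSpace ℝ (Fin (m + 2)) | R₁ < ‖y‖ ∧ ‖y‖ < R₂} :=
      (isOpen_lt continuous_const continuous_norm).inter
        (isOpen_lt continuous_norm continuous_const)
    exact mem_of_superset (ho.mem_nhds ⟨hp₁, hp₂⟩) fun y hy => ⟨hy.1.le, hy.2.le⟩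
  obtain ⟨hC, hL⟩ := hw p hp₁ hp₂
  obtain ⟨hC', hL'⟩ := eLaplacian_const_add_inv_norm_pow (m := m) A B (z := p)
    (norm_ne_zero_iff.1 (hne p hpK))
  have h0 := eLaplacian_nonneg_of_isLocalMin (hC.sub hC') (hp.isLocalMin hnb)
  have h1 : eLaplacian (fun y => w y - h y) p = eLaplacian w p - eLaplacian h p :=
    eLaplacian_sub hC hC'
  have h2 : eLaplacian h p = 0 := hL'
  have h3 : 0 ≤ eLaplacian (fun y => w y - h y) p := h0
  linarith

/-- A nonnegative strictly superharmonic function on a punctured ball is bounded below by its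
boundary values. -/
theorem le_of_superharmonic_punctured {m : ℕ} (hm : 1 ≤ m) {R c : ℝ}
    {w : EuclideanSpace ℝ (Fin (m + 2)) → ℝ}
    (hw : ∀ z, z ≠ 0 → ‖z‖ ≤ R → ContDiffAt ℝ 2 w z ∧ eLaplacian w z < 0)
    (h0 : ∀ z, z ≠ 0 → ‖z‖ ≤ R → 0 ≤ w z) (hc : ∀ z, ‖z‖ = R → c ≤ w z)
    {z : EuclideanSpace ℝ (Fin (m + 2))} (hz : z ≠ 0) (hzR : ‖z‖ ≤ R) : c ≤ w z := by
  have hρ : 0 < ‖z‖ := norm_pos_iff.2 hz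
  refine le_of_forall_pos_le_add fun δ hδ => ?_
  have hε : 0 < δ * ‖z‖ ^ m := by positivity
  set ε := δ * ‖z‖ ^ m with hεd
  set r : ℝ := min ‖z‖ (min 1 (ε / (|c| + 1))) with hr
  have hr0 : 0 < r := by positivity
  have hne : ∀ y : EuclideanSpace ℝ (Fin (m + 2)), r ≤ ‖y‖ → y ≠ 0 := fun y hy =>
    norm_pos_iff.1 (hr0.trans_le hy)
  have hr1 : r ≤ 1 := (min_le_right _ _).trans (min_le_left _ _)
  have hr2 : r ≤ ε / (|c| + 1) := (min_le_right _ _).trans (min_le_right _ _)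
  have hrc : c ≤ ε * (1 / r) ^ m := by
    have h1 : 1 / r ≤ (1 / r) ^ m :=
      le_self_pow₀ (by rw [le_div_iff₀ hr0]; linarith) (by omega)
    have h2 : |c| + 1 ≤ ε * (1 / r) := by
      rw [mul_one_div, le_div_iff₀ hr0]
      rw [le_div_iff₀ (by positivity)] at hr2
      linarith
    have h3 := mul_le_mul_of_nonneg_left h1 hε.le
    linarith [le_abs_self c]
  have h := annulus_comparison (m := m) (R₁ := r) (R₂ := R) (w := w) hr0
    (fun y hy => (hw y (hne y hy.1) hy.2).1.continuousAt.continuousWithinAt)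
    (fun y hy₁ hy₂ => hw y (hne y hy₁.le) hy₂.le) (A := c) (B := -ε)
    (fun y hy => by
      have := h0 y (hne y hy.ge) (hy.trans_le ((min_le_left _ _).trans hzR))
      linarith)
    (fun y hy => by
      have h1 := hc y hy
      have h2 : 0 ≤ ε * (1 / R) ^ m := by
        have : 0 ≤ R := hρ.le.trans hzR
        positivity
      linarith) (min_le_left _ _) hzR
  have h4 : ε * (1 / ‖z‖) ^ m = δ := by
    rw [hεd, one_div, inv_pow]
    field_simp
  linarith

/-- A nonnegative strictly superharmonic function near infinity decays at most like the
fundamental solution. -/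
theorem decay_of_superharmonic {m : ℕ} (hm : 1 ≤ m) {R c : ℝ} (hR : 0 < R) (hc0 : 0 ≤ c)
    {w : EuclideanSpace ℝ (Fin (m + 2)) → ℝ}
    (hw : ∀ z, R ≤ ‖z‖ → ContDiffAt ℝ 2 w z ∧ eLaplacian w z < 0)
    (h0 : ∀ z, R ≤ ‖z‖ → 0 ≤ w z) (hc : ∀ z, ‖z‖ = R → c ≤ w z)
    {z : EuclideanSpace ℝ (Fin (m + 2))} (hzR : R ≤ ‖z‖) : c * (R / ‖z‖) ^ m ≤ w z := by
  refine le_of_forall_pos_le_add fun δ hδ => ?_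
  set R' : ℝ := max ‖z‖ (R * (1 + c / δ)) with hR'
  have h1 : ‖z‖ ≤ R' := le_max_left _ _
  have h2 : R * (1 + c / δ) ≤ R' := le_max_right _ _
  have hR0 : 0 < R' := hR.trans_le (hzR.trans h1)
  have hRR : R / R' ≤ 1 := (div_le_one hR0).2 (hzR.trans h1)
  have h3 : c * (R / R') ^ m ≤ δ := by
    have h4 : (R / R') ^ m ≤ R / R' := pow_le_of_le_one (by positivity) hRR (by omega)
    have h5 : c * (R / R') ≤ δ := by
      rw [mul_div_assoc', div_le_iff₀ hR0]
      have h6 := mul_le_mul_of_nonneg_left h2 hδ.le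
      have h7 : δ * (R * (1 + c / δ)) = δ * R + c * R := by field_simp
      nlinarith
    exact (mul_le_mul_of_nonneg_left h4 hc0).trans h5
  have hB : ∀ s : ℝ, c * R ^ m * (1 / s) ^ m = c * (R / s) ^ m := fun s => by
    rw [mul_assoc, ← mul_pow, mul_one_div]
  have h := annulus_comparison (m := m) (R₁ := R) (R₂ := R') (w := w) hR
    (fun y hy => (hw y hy.1).1.continuousAt.continuousWithinAt)
    (fun y hy₁ _ => hw y hy₁.le) (A := -δ) (B := c * R ^ m)
    (fun y hy => by
      have h8 := hc y hy
      rw [hB, div_self hR.ne', one_pow]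
      linarith)
    (fun y hy => by
      have h8 := h0 y (hy ▸ hzR.trans h1)
      rw [hB]
      linarith) hzR h1
  rw [hB] at h
  linarith

theorem IsCompact.exists_pos_forall_le {X : Type*} [TopologicalSpace X] {K : Set X}
    (hK : IsCompact K) {f : X → ℝ} (hf : ContinuousOn f K) (hpos : ∀ x ∈ K, 0 < f x) :
    ∃ c : ℝ, 0 < c ∧ ∀ x ∈ K, c ≤ f x := by
  rcases K.eq_empty_or_nonempty with rfl | hne
  · exact ⟨1, one_pos, by simp⟩
  · obtain ⟨p, hp, hm⟩ := hK.exists_isMinOn hne hf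
    exact ⟨f p, hpos p hp, fun x hx => hm hx⟩

/-- The properties of a positive function on the punctured space on which the method of moving
spheres relies: strict superharmonicity of the function, and of its difference with each Kelvin
transform wherever that difference is nonnegative. -/
structure SphereSuperharmonic (m : ℕ) (u : EuclideanSpace ℝ (Fin (m + 2)) → ℝ) : Prop where
  contDiffAt : ∀ x, x ≠ 0 → ContDiffAt ℝ 2 u x
  pos : ∀ x, x ≠ 0 → 0 < u x
  lap_neg : ∀ x, x ≠ 0 → eLaplacian u x < 0
  lap_sub_kelvin_neg : ∀ x, x ≠ 0 → ∀ l, 0 < l → l < ‖x‖ → ∀ z, l < ‖z‖ → x + z ≠ 0 →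
    kelvin m (fun z => u (x + z)) l z ≤ u (x + z) →
    eLaplacian (fun z => u (x + z) - kelvin m (fun z => u (x + z)) l z) z < 0

/-- Outside the sphere of radius `l` about `x`, `u` dominates its Kelvin transform. -/
def DominatesKelvin (m : ℕ) (u : EuclideanSpace ℝ (Fin (m + 2)) → ℝ)
    (x : EuclideanSpace ℝ (Fin (m + 2))) (l : ℝ) : Prop :=
  ∀ z, l ≤ ‖z‖ → x + z ≠ 0 → kelvin m (fun z => u (x + z)) l z ≤ u (x + z)

theorem add_kelvin_point_ne_zero {n : ℕ} {x z : EuclideanSpace ℝ (Fin n)} {l : ℝ} (hz : z ≠ 0)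
    (h : l ^ 2 < ‖x‖ * ‖z‖) : x + (l ^ 2 / ‖z‖ ^ 2) • z ≠ 0 := by
  intro h0
  have hz' : 0 < ‖z‖ := norm_pos_iff.2 hz
  have h1 : ‖x‖ = l ^ 2 / ‖z‖ := by
    rw [eq_neg_of_add_eq_zero_left h0, norm_neg, norm_smul, Real.norm_of_nonneg (by positivity)]
    field_simp
  rw [h1, div_mul_cancel₀ _ hz'.ne'] at h
  exact lt_irrefl _ h

theorem kelvin_of_norm_eq {n m : ℕ} (f : EuclideanSpace ℝ (Fin n) → ℝ) {l : ℝ} (hl : 0 < l)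
    {z : EuclideanSpace ℝ (Fin n)} (hz : ‖z‖ = l) : kelvin m f l z = f z := by
  rw [kelvin, hz, div_self hl.ne', div_self (pow_ne_zero 2 hl.ne'), one_pow, one_mul, one_smul]

theorem continuousAt_kelvin_uncurry {n m : ℕ} {f : EuclideanSpace ℝ (Fin n) → ℝ} {l : ℝ}
    {z : EuclideanSpace ℝ (Fin n)} (hz : z ≠ 0)
    (hf : ContinuousAt f ((l ^ 2 / ‖z‖ ^ 2) • z)) :
    ContinuousAt (fun p : ℝ × EuclideanSpace ℝ (Fin n) => kelvin m f p.1 p.2) (l, z) := by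
  have h0 : ‖z‖ ≠ 0 := norm_ne_zero_iff.2 hz
  have h1 : ContinuousAt (fun p : ℝ × EuclideanSpace ℝ (Fin n) => ‖p.2‖) (l, z) := by fun_prop
  refine ((continuousAt_fst.div h1 h0).pow m).mul (ContinuousAt.comp (g := f) hf ?_)
  exact ((continuousAt_fst.pow 2).div (h1.pow 2) (pow_ne_zero 2 h0)).smul continuousAt_snd

/-- If `s ↦ s ^ m * f (s • z) ^ 2` is increasing, then `f` dominates its Kelvin transform. -/
theorem kelvin_le_of_radial_deriv_pos {n m : ℕ} {f : EuclideanSpace ℝ (Fin n) → ℝ} {l : ℝ}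
    (hl : 0 < l) {z : EuclideanSpace ℝ (Fin n)} (hz : l ≤ ‖z‖)
    (h : ∀ s, l ^ 2 / ‖z‖ ^ 2 ≤ s → s ≤ 1 → DifferentiableAt ℝ f (s • z) ∧ 0 < f (s • z) ∧
      0 < m * f (s • z) + 2 * fderiv ℝ f (s • z) (s • z)) :
    kelvin m f l z ≤ f z := by
  have hz0 : 0 < ‖z‖ := hl.trans_le hz
  set t := l ^ 2 / ‖z‖ ^ 2 with ht
  have ht0 : 0 < t := by positivity
  have ht1 : t ≤ 1 := (div_le_one (by positivity)).2 (by gcongr)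
  have hd : ∀ s ∈ Icc t 1, HasDerivAt (fun s : ℝ => s ^ m * f (s • z) ^ 2)
      (m * s ^ (m - 1) * f (s • z) ^ 2 + s ^ m * (2 * f (s • z) * fderiv ℝ f (s • z) z)) s := by
    intro s hs
    have hl : HasDerivAt (fun s : ℝ => s • z) z s := by
      simpa using (hasDerivAt_id s).smul_const z
    have h1 : HasDerivAt (fun s : ℝ => f (s • z)) (fderiv ℝ f (s • z) z) s :=
      (h s hs.1 hs.2).1.hasFDerivAt.comp_hasDerivAt (f := fun s : ℝ => s • z) s hl
    exact HasDerivAt.congr_deriv ((hasDerivAt_pow m s).mul (h1.pow 2)) (by simp)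
  have hmono : MonotoneOn (fun s : ℝ => s ^ m * f (s • z) ^ 2) (Icc t 1) := by
    refine monotoneOn_of_deriv_nonneg (convex_Icc t 1)
      (fun s hs => (hd s hs).continuousAt.continuousWithinAt)
      (fun s hs => (hd s (interior_subset hs)).differentiableAt.differentiableWithinAt)
      fun s hs => ?_
    have hs' := interior_subset hs
    rw [(hd s hs').deriv]
    obtain ⟨-, h2, h3⟩ := h s hs'.1 hs'.2
    have hs0 : 0 < s := ht0.trans_le hs'.1
    rw [map_smul, smul_eq_mul] at h3
    have h4 : s * (m * s ^ (m - 1) * f (s • z) ^ 2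
        + s ^ m * (2 * f (s • z) * fderiv ℝ f (s • z) z))
        = s ^ m * f (s • z) * (m * f (s • z) + 2 * (s * fderiv ℝ f (s • z) z)) := by
      rcases m with _ | k
      · simp; ring
      · simp only [Nat.add_sub_cancel, pow_succ]; ring
    have h5 : 0 < s ^ m * f (s • z) * (m * f (s • z) + 2 * (s * fderiv ℝ f (s • z) z)) := by
      positivity
    rw [← h4] at h5
    exact (pos_of_mul_pos_right h5 hs0.le).le
  have h1 := hmono ⟨le_rfl, ht1⟩ ⟨ht1, le_rfl⟩ ht1
  have h2 : t ^ m * f (t • z) ^ 2 = kelvin m f l z ^ 2 := by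
    rw [kelvin, mul_pow, ← pow_mul, mul_comm m 2, pow_mul, div_pow l]
  have h3 : (0 : ℝ) < f z := by simpa using (h 1 ht1 le_rfl).2.1
  simp only [h2, one_pow, one_mul, one_smul] at h1
  exact abs_le_of_sq_le_sq' h1 h3.le |>.2

theorem HasDerivAt.nonneg_of_eventually_le {g : ℝ → ℝ} {d x : ℝ} (hg : HasDerivAt g d x)
    (h : ∀ᶠ s in 𝓝[>] x, g x ≤ g s) : 0 ≤ d := by
  have h1 : Tendsto (slope g x) (𝓝[>] x) (𝓝 d) :=
    hg.tendsto_slope.mono_left (nhdsWithin_mono _ fun y hy => (ne_of_gt hy))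
  refine ge_of_tendsto h1 ?_
  filter_upwards [h, self_mem_nhdsWithin] with s hs hs'
  rw [slope_def_field]
  exact div_nonneg (sub_nonneg.2 hs) (sub_nonneg.2 (le_of_lt hs'))

namespace SphereSuperharmonic

variable {m : ℕ} {u : EuclideanSpace ℝ (Fin (m + 2)) → ℝ}

theorem contDiffAt_translate (hu : SphereSuperharmonic m u) {x z : EuclideanSpace ℝ (Fin (m + 2))}
    (h : x + z ≠ 0) : ContDiffAt ℝ 2 (fun z => u (x + z)) z :=
  ContDiffAt.comp (g := u) z (hu.contDiffAt _ h) (contDiffAt_const.add contDiffAt_id)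

theorem contDiffAt_kelvin (hu : SphereSuperharmonic m u) {x z : EuclideanSpace ℝ (Fin (m + 2))}
    {l : ℝ} (hz : z ≠ 0) (h : l ^ 2 < ‖x‖ * ‖z‖) :
    ContDiffAt ℝ 2 (kelvin m (fun z => u (x + z)) l) z :=
  _root_.contDiffAt_kelvin hz (hu.contDiffAt_translate (add_kelvin_point_ne_zero hz h))

theorem kelvin_lt (hu : SphereSuperharmonic m u) {x : EuclideanSpace ℝ (Fin (m + 2))} {l : ℝ}
    (hl : 0 < l) (hlx : l < ‖x‖) (hd : DominatesKelvin m u x l)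
    {z : EuclideanSpace ℝ (Fin (m + 2))} (hz : l < ‖z‖) (hxz : x + z ≠ 0) :
    kelvin m (fun z => u (x + z)) l z < u (x + z) := by
  refine lt_of_le_of_ne (hd z hz.le hxz) fun he => ?_
  have hx : x ≠ 0 := norm_pos_iff.1 (hl.trans hlx)
  have hz0 : z ≠ 0 := norm_pos_iff.1 (hl.trans hz)
  have hC := (hu.contDiffAt_translate hxz).sub
    (hu.contDiffAt_kelvin (x := x) (l := l) hz0 (by nlinarith))
  have hmin : IsLocalMin (fun z => u (x + z) - kelvin m (fun z => u (x + z)) l z) z := by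
    have h1 : ∀ᶠ y in 𝓝 z, l < ‖y‖ := continuousAt_id.norm.eventually (lt_mem_nhds hz)
    have h2 : ∀ᶠ y in 𝓝 z, x + y ≠ 0 :=
      (continuousAt_const.add continuousAt_id).eventually_ne hxz
    filter_upwards [h1, h2] with y h3 h4
    have := hd y h3.le h4
    simp only [he, sub_self]
    linarith
  exact absurd (eLaplacian_nonneg_of_isLocalMin hC hmin)
    (not_le.2 (hu.lap_sub_kelvin_neg x hx l hl hlx z hz hxz he.le))

/-- Boundary-point lemma on the sphere of inversion. -/
theorem radial_deriv_pos (hm : 1 ≤ m) (hu : SphereSuperharmonic m u)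
    {x : EuclideanSpace ℝ (Fin (m + 2))} {l : ℝ} (hl : 0 < l) (hlx : l < ‖x‖)
    (hd : DominatesKelvin m u x l) {z : EuclideanSpace ℝ (Fin (m + 2))} (hz : ‖z‖ = l) :
    0 < m * u (x + z) + 2 * fderiv ℝ (fun z => u (x + z)) z z := by
  have hx : x ≠ 0 := norm_pos_iff.1 (hl.trans hlx)
  set f : EuclideanSpace ℝ (Fin (m + 2)) → ℝ := fun z => u (x + z) with hf
  set R := (l + ‖x‖) / 2 with hR
  have hlR : l < R := by linarith
  have hR0 : 0 < R := hl.trans hlR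
  have hxy : ∀ y : EuclideanSpace ℝ (Fin (m + 2)), ‖y‖ ≤ R → x + y ≠ 0 := fun y hy h0 => by
    have := congrArg norm (eq_neg_of_add_eq_zero_left h0)
    rw [norm_neg] at this
    linarith
  have hC : ∀ y : EuclideanSpace ℝ (Fin (m + 2)), l ≤ ‖y‖ → ‖y‖ ≤ R →
      ContDiffAt ℝ 2 (fun y => f y - kelvin m f l y) y := fun y h1 h2 =>
    (hu.contDiffAt_translate (hxy y h2)).sub
      (hu.contDiffAt_kelvin (norm_pos_iff.1 (hl.trans_le h1)) (by nlinarith))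
  obtain ⟨c, hc0, hc⟩ := (isCompact_sphere (0 : EuclideanSpace ℝ (Fin (m + 2))) R
    ).exists_pos_forall_le (f := fun y => f y - kelvin m f l y)
    (fun y hy => by
      have hy' : ‖y‖ = R := by simpa using hy
      exact (hC y (hy' ▸ hlR.le) hy'.le).continuousAt.continuousWithinAt)
    (fun y hy => by
      have hy' : ‖y‖ = R := by simpa using hy
      exact sub_pos.2 (hu.kelvin_lt hl hlx hd (hy' ▸ hlR) (hxy y hy'.le)))
  have hgap : 0 < (1 / l) ^ m - (1 / R) ^ m := by
    have : (1 / R) ^ m < (1 / l) ^ m := by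
      refine pow_lt_pow_left₀ (one_div_lt_one_div_of_lt hl hlR) (by positivity) (by omega)
    linarith
  set κ := c / ((1 / l) ^ m - (1 / R) ^ m) with hκ
  have hκ0 : 0 < κ := div_pos hc0 hgap
  have hcmp : ∀ y : EuclideanSpace ℝ (Fin (m + 2)), l ≤ ‖y‖ → ‖y‖ ≤ R →
      κ * (1 / l) ^ m + -κ * (1 / ‖y‖) ^ m ≤ f y - kelvin m f l y := by
    intro y h1 h2
    refine annulus_comparison (w := fun y => f y - kelvin m f l y) hl
      (fun y hy => (hC y hy.1 hy.2).continuousAt.continuousWithinAt)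
      (fun y h3 h4 => ⟨hC y h3.le h4.le, hu.lap_sub_kelvin_neg x hx l hl hlx y h3 (hxy y h4.le)
        (hd y h3.le (hxy y h4.le))⟩) (fun y hy => ?_) (fun y hy => ?_) h1 h2
    · rw [kelvin_of_norm_eq f hl hy]
      linarith
    · have h5 := hc y (by simpa using hy)
      have h6 : κ * ((1 / l) ^ m - (1 / R) ^ m) = c := div_mul_cancel₀ _ hgap.ne'
      linarith
  set g : ℝ → ℝ := fun s => f (s • z) - s⁻¹ ^ m * f (s⁻¹ • z) - κ * (1 / l) ^ m * (1 - s⁻¹ ^ m)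
    with hg
  have hinv : HasDerivAt (fun s : ℝ => s⁻¹) (-1) 1 := by
    simpa using hasDerivAt_inv (one_ne_zero (α := ℝ))
  have hpow : HasDerivAt (fun s : ℝ => s⁻¹ ^ m) (-m) 1 := by
    exact HasDerivAt.congr_deriv (hinv.pow m) (by simp)
  have hfd : ∀ {q : ℝ → ℝ} {q' : ℝ}, HasDerivAt q q' 1 → q 1 = 1 →
      HasDerivAt (fun s : ℝ => f (q s • z)) (q' * fderiv ℝ f z z) 1 := by
    intro q q' hq hq1
    have h1 : HasFDerivAt f (fderiv ℝ f z) (q 1 • z) := by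
      rw [hq1, one_smul]
      exact ((hu.contDiffAt_translate (hxy z (hz ▸ hlR.le))).differentiableAt
        (by simp)).hasFDerivAt
    exact (h1.comp_hasDerivAt (f := fun s : ℝ => q s • z) 1 (hq.smul_const z)).congr_deriv
      (by simp)
  have hgd : HasDerivAt g (m * f z + 2 * fderiv ℝ f z z - κ * (1 / l) ^ m * m) 1 := by
    refine HasDerivAt.congr_deriv (((hfd (hasDerivAt_id 1) rfl).sub
      (hpow.mul (hfd hinv inv_one))).sub
      ((hpow.const_sub 1).const_mul (κ * (1 / l) ^ m))) ?_
    simp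
    ring
  have h0 : 0 ≤ m * f z + 2 * fderiv ℝ f z z - κ * (1 / l) ^ m * m := by
    refine hgd.nonneg_of_eventually_le ?_
    have hR1 : 1 < R / l := (one_lt_div hl).2 hlR
    filter_upwards [Ioo_mem_nhdsGT hR1] with s hs
    have hs0 : 0 < s := one_pos.trans hs.1
    have hsz : ‖s • z‖ = s * l := by rw [norm_smul, hz, Real.norm_of_nonneg hs0.le]
    have h1 := hcmp (s • z) (by rw [hsz]; nlinarith [hs.1])
      (by rw [hsz]; exact ((lt_div_iff₀ hl).1 hs.2).le)
    have h2 : kelvin m f l (s • z) = s⁻¹ ^ m * f (s⁻¹ • z) := by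
      rw [kelvin, hsz, smul_smul]
      congr 2
      · field_simp
      · congr 1
        field_simp
    have h3 : (1 / ‖s • z‖) ^ m = (1 / l) ^ m * s⁻¹ ^ m := by
      rw [hsz, ← mul_pow]
      congr 1
      field_simp
    rw [h2, h3] at h1
    simp only [hg, inv_one, one_pow, one_mul, one_smul, sub_self, mul_zero]
    linarith
  have hm' : (0 : ℝ) < m := by exact_mod_cast hm
  have : 0 < κ * (1 / l) ^ m * m := by positivity
  linarith

theorem continuousAt_radial_deriv (hu : SphereSuperharmonic m u)
    {x z : EuclideanSpace ℝ (Fin (m + 2))} (hxz : x + z ≠ 0) :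
    ContinuousAt (fun z => m * u (x + z) + 2 * fderiv ℝ (fun z => u (x + z)) z z) z := by
  have h := hu.contDiffAt_translate hxz
  have h1 : ContinuousAt (fderiv ℝ (fun z => u (x + z))) z := by
    have h2 : ContDiffAt ℝ 1 (fderiv ℝ (fun z => u (x + z))) z := h.fderiv_right (by norm_num)
    exact h2.continuousAt
  exact (continuousAt_const.mul h.continuousAt).add
    (continuousAt_const.mul (h1.clm_apply continuousAt_id))

/-- Positive lower bounds for `u`, on a punctured ball and near infinity. -/
theorem exists_lower_bounds (hm : 1 ≤ m) (hu : SphereSuperharmonic m u)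
    {x : EuclideanSpace ℝ (Fin (m + 2))} {R : ℝ} (hR : ‖x‖ < R) :
    ∃ c, 0 < c ∧ (∀ z, ‖z‖ ≤ R → x + z ≠ 0 → c ≤ u (x + z)) ∧
      ∀ z, R ≤ ‖z‖ → c * (R / ‖z‖) ^ m ≤ u (x + z) := by
  have hR0 : 0 < R := (norm_nonneg x).trans_lt hR
  have hne : ∀ z : EuclideanSpace ℝ (Fin (m + 2)), R ≤ ‖z‖ → x + z ≠ 0 := fun z hz h0 => by
    have := congrArg norm (eq_neg_of_add_eq_zero_left h0)
    rw [norm_neg] at this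
    linarith
  have hRx : 0 < ‖x‖ + R := by positivity
  obtain ⟨c₁, hc₁, h₁⟩ := (isCompact_sphere (0 : EuclideanSpace ℝ (Fin (m + 2))) (‖x‖ + R)
    ).exists_pos_forall_le (f := u)
    (fun y hy => (hu.contDiffAt y (ne_zero_of_mem_sphere hRx.ne' ⟨y, hy⟩)
      ).continuousAt.continuousWithinAt)
    (fun y hy => hu.pos y (ne_zero_of_mem_sphere hRx.ne' ⟨y, hy⟩))
  have h₁' : ∀ z, ‖z‖ ≤ R → x + z ≠ 0 → c₁ ≤ u (x + z) := fun z hz hxz =>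
    le_of_superharmonic_punctured hm (R := ‖x‖ + R)
      (fun y hy _ => ⟨hu.contDiffAt y hy, hu.lap_neg y hy⟩) (fun y hy _ => (hu.pos y hy).le)
      (fun y hy => h₁ y (by simpa using hy)) hxz
      ((norm_add_le x z).trans (add_le_add_right hz _))
  refine ⟨c₁, hc₁, h₁', fun z hz => ?_⟩
  refine decay_of_superharmonic hm hR0 hc₁.le (w := fun z => u (x + z))
    (fun y hy => ⟨hu.contDiffAt_translate (hne y hy), ?_⟩) (fun y hy => (hu.pos _ (hne y hy)).le)
    (fun y hy => h₁' y hy.le (hne y hy.ge)) hz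
  rw [eLaplacian_comp_add_left]
  exact hu.lap_neg _ (hne y hy)

theorem exists_dominatesKelvin_of_lt (hm : 1 ≤ m) (hu : SphereSuperharmonic m u)
    {x : EuclideanSpace ℝ (Fin (m + 2))} (hx : x ≠ 0) :
    ∃ l₀, 0 < l₀ ∧ ∀ l, 0 < l → l < l₀ → DominatesKelvin m u x l := by
  have hx0 : 0 < ‖x‖ := norm_pos_iff.2 hx
  have hm' : (0 : ℝ) < m := by exact_mod_cast hm
  have hD : ∀ᶠ z in 𝓝 (0 : EuclideanSpace ℝ (Fin (m + 2))),
      0 < m * u (x + z) + 2 * fderiv ℝ (fun z => u (x + z)) z z := by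
    refine (hu.continuousAt_radial_deriv (by simpa using hx)).eventually (lt_mem_nhds ?_)
    have := hu.pos x hx
    simp only [add_zero, map_zero, mul_zero]
    positivity
  obtain ⟨δ, hδ, hball⟩ := Metric.eventually_nhds_iff.1 hD
  set r := min (δ / 2) (‖x‖ / 2) with hr
  have hr0 : 0 < r := by positivity
  have hrδ : r < δ := (min_le_left _ _).trans_lt (by linarith)
  have hrx : r < ‖x‖ := (min_le_right _ _).trans_lt (by linarith)
  have hne : ∀ z : EuclideanSpace ℝ (Fin (m + 2)), ‖z‖ ≤ r → x + z ≠ 0 := fun z hz h0 => by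
    have := congrArg norm (eq_neg_of_add_eq_zero_left h0)
    rw [norm_neg] at this
    linarith
  obtain ⟨c, hc, hc₁, hc₂⟩ := hu.exists_lower_bounds hm (x := x) (R := 2 * ‖x‖) (by linarith)
  obtain ⟨M, hM⟩ := (isCompact_closedBall (0 : EuclideanSpace ℝ (Fin (m + 2))) r
    ).exists_bound_of_continuousOn (f := fun z => u (x + z))
    (fun y hy => (hu.contDiffAt_translate (hne y (by simpa using hy))
      ).continuousAt.continuousWithinAt)
  have hM' : ∀ z : EuclideanSpace ℝ (Fin (m + 2)), ‖z‖ ≤ r → u (x + z) ≤ max M 1 := fun z hz =>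
    (le_abs_self _).trans ((hM z (by simpa using hz)).trans (le_max_left _ _))
  set N := max M 1 with hN
  have hN0 : 0 < N := one_pos.trans_le (le_max_right _ _)
  refine ⟨min r (c * r / N), by positivity, fun l hl hl₀ z hz hxz => ?_⟩
  have hlr : l < r := hl₀.trans_le (min_le_left _ _)
  have hlN : l * N < c * r := (lt_div_iff₀ hN0).1 (hl₀.trans_le (min_le_right _ _))
  have hz0 : 0 < ‖z‖ := hl.trans_le hz
  rcases le_total ‖z‖ r with hzr | hzr
  · refine kelvin_le_of_radial_deriv_pos hl hz fun s hs₀ hs₁ => ?_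
    have hs : 0 ≤ s := le_trans (by positivity) hs₀
    have hsz : ‖s • z‖ ≤ r := by
      rw [norm_smul, Real.norm_of_nonneg hs]
      nlinarith
    exact ⟨(hu.contDiffAt_translate (hne _ hsz)).differentiableAt (by simp),
      hu.pos _ (hne _ hsz), hball (by simpa using hsz.trans_lt hrδ)⟩
  · have hpt : u (x + (l ^ 2 / ‖z‖ ^ 2) • z) ≤ N := by
      refine hM' _ ?_
      rw [norm_smul, Real.norm_of_nonneg (by positivity)]
      have : l ^ 2 / ‖z‖ ^ 2 * ‖z‖ = l * (l / ‖z‖) := by field_simp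
      rw [this]
      have h1 : l / ‖z‖ ≤ 1 := (div_le_one hz0).2 hz
      nlinarith
    have hK : kelvin m (fun z => u (x + z)) l z ≤ (l / ‖z‖) ^ m * N :=
      mul_le_mul_of_nonneg_left hpt (by positivity)
    have hlrm : (l / r) ^ m * N ≤ c := by
      have h1 : (l / r) ^ m ≤ l / r :=
        pow_le_of_le_one (by positivity) ((div_le_one hr0).2 hlr.le) (by omega)
      have h2 : l / r * N ≤ c := by
        rw [div_mul_eq_mul_div, div_le_iff₀ hr0]
        exact hlN.le
      exact (mul_le_mul_of_nonneg_right h1 hN0.le).trans h2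
    refine hK.trans ?_
    rcases le_total ‖z‖ (2 * ‖x‖) with hzx | hzx
    · refine le_trans ?_ (hc₁ z hzx hxz)
      refine le_trans ?_ hlrm
      gcongr
    · refine le_trans ?_ (hc₂ z hzx)
      have h1 : (l / ‖z‖) ^ m * N = (l / r) ^ m * N * (r / ‖z‖) ^ m := by
        rw [mul_right_comm, ← mul_pow]
        congr 2
        field_simp
      rw [h1]
      gcongr
      linarith

theorem dominatesKelvin_of_forall_lt (hu : SphereSuperharmonic m u)
    {x : EuclideanSpace ℝ (Fin (m + 2))} {l : ℝ} (hl : 0 < l) (hlx : l ≤ ‖x‖)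
    (h : ∀ l', 0 < l' → l' < l → DominatesKelvin m u x l') : DominatesKelvin m u x l := by
  intro z hz hxz
  rcases hz.eq_or_lt with he | hlz
  · exact (kelvin_of_norm_eq (fun z => u (x + z)) hl he.symm).le
  have hz0 : z ≠ 0 := norm_pos_iff.1 (hl.trans hlz)
  have hpt := add_kelvin_point_ne_zero (x := x) (l := l) hz0 (by nlinarith)
  have hc : ContinuousAt (fun l' => kelvin m (fun z => u (x + z)) l' z) l :=
    ContinuousAt.comp
      (g := fun p : ℝ × EuclideanSpace ℝ (Fin (m + 2)) => kelvin m (fun z => u (x + z)) p.1 p.2)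
      (f := fun l' : ℝ => (l', z))
      (continuousAt_kelvin_uncurry hz0 (hu.contDiffAt_translate hpt).continuousAt) (by fun_prop)
  refine le_of_tendsto (hc.tendsto.mono_left (nhdsWithin_le_nhds (s := Iio l))) ?_
  filter_upwards [Ioo_mem_nhdsLT hl] with l' hl'
  exact h l' hl'.1 hl'.2 z (hl'.2.le.trans hz) hxz

theorem eventually_kelvin_le (hm : 1 ≤ m) (hu : SphereSuperharmonic m u)
    {x : EuclideanSpace ℝ (Fin (m + 2))} {l : ℝ} (hl : 0 < l) (hlx : l < ‖x‖)
    (hd : DominatesKelvin m u x l) (z₀ : EuclideanSpace ℝ (Fin (m + 2))) :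
    ∀ᶠ p : ℝ × EuclideanSpace ℝ (Fin (m + 2)) in 𝓝 (l, z₀), p.1 ≤ ‖p.2‖ → x + p.2 ≠ 0 →
      kelvin m (fun z => u (x + z)) p.1 p.2 ≤ u (x + p.2) := by
  have hx : x ≠ 0 := norm_pos_iff.1 (hl.trans hlx)
  have hsnd : Tendsto (Prod.snd : ℝ × EuclideanSpace ℝ (Fin (m + 2)) → _) (𝓝 (l, z₀)) (𝓝 z₀) :=
    continuousAt_snd
  have hfst : Tendsto (Prod.fst : ℝ × EuclideanSpace ℝ (Fin (m + 2)) → _) (𝓝 (l, z₀)) (𝓝 l) :=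
    continuousAt_fst
  rcases lt_trichotomy ‖z₀‖ l with hz | hz | hz
  · filter_upwards [hsnd.norm.eventually_lt hfst hz] with p hp hp'
    exact absurd hp (not_lt.2 hp')
  · have hz0 : z₀ ≠ 0 := norm_pos_iff.1 (hz ▸ hl)
    have hxz : x + z₀ ≠ 0 := fun h0 => by
      have := congrArg norm (eq_neg_of_add_eq_zero_left h0)
      rw [norm_neg] at this
      linarith
    have hD := (hu.continuousAt_radial_deriv hxz).eventually
      (lt_mem_nhds (hu.radial_deriv_pos hm hl hlx hd hz))
    have hne : ∀ᶠ y in 𝓝 z₀, x + y ≠ 0 :=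
      (continuousAt_const.add continuousAt_id).eventually_ne hxz
    obtain ⟨δ, hδ, hball⟩ := Metric.eventually_nhds_iff_ball.1 (hD.and hne)
    have hin : ∀ᶠ y in 𝓝 z₀, y ∈ Metric.ball z₀ δ := Metric.ball_mem_nhds z₀ hδ
    have hsc : Tendsto (fun p : ℝ × EuclideanSpace ℝ (Fin (m + 2)) =>
        (p.1 ^ 2 / ‖p.2‖ ^ 2) • p.2) (𝓝 (l, z₀)) (𝓝 z₀) := by
      have h1 := ((hfst.pow 2).div (hsnd.norm.pow 2)
        (pow_ne_zero 2 (norm_ne_zero_iff.2 hz0))).smul hsnd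
      rwa [hz, div_self (pow_ne_zero 2 hl.ne'), one_smul] at h1
    filter_upwards [hsnd.eventually hin, hsc.eventually hin, hfst.eventually (lt_mem_nhds hl)]
      with p h1 h2 h3 h4 _
    refine kelvin_le_of_radial_deriv_pos h3 h4 fun s hs₀ hs₁ => ?_
    have hconv : Convex ℝ {s : ℝ | s • p.2 ∈ Metric.ball z₀ δ} :=
      (convex_ball z₀ δ).is_linear_preimage (f := fun s : ℝ => s • p.2)
        (IsLinearMap.mk (fun a b => add_smul a b p.2) (fun a b => smul_assoc a b p.2))
    have hs : s • p.2 ∈ Metric.ball z₀ δ :=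
      hconv.ordConnected.out h2 (show (1 : ℝ) • p.2 ∈ _ by rwa [one_smul]) ⟨hs₀, hs₁⟩
    obtain ⟨h5, h6⟩ := hball _ hs
    exact ⟨(hu.contDiffAt_translate h6).differentiableAt (by simp), hu.pos _ h6, h5⟩
  · have hz0 : z₀ ≠ 0 := norm_pos_iff.1 (hl.trans hz)
    have hpt := add_kelvin_point_ne_zero (x := x) (l := l) hz0 (by nlinarith)
    have hK : ContinuousAt (fun p : ℝ × EuclideanSpace ℝ (Fin (m + 2)) =>
        kelvin m (fun z => u (x + z)) p.1 p.2) (l, z₀) :=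
      continuousAt_kelvin_uncurry hz0 (hu.contDiffAt_translate hpt).continuousAt
    by_cases hxz : x + z₀ = 0
    · obtain rfl : z₀ = -x := (neg_eq_of_add_eq_zero_right hxz).symm
      set R := (‖x‖ - l) / 2 with hR
      have hR0 : 0 < R := by linarith
      have hout : ∀ y : EuclideanSpace ℝ (Fin (m + 2)), ‖y‖ ≤ R → l < ‖-x + y‖ := fun y hy => by
        have := norm_sub_norm_le x y
        rw [neg_add_eq_sub, norm_sub_rev]
        linarith
      set w : EuclideanSpace ℝ (Fin (m + 2)) → ℝ :=
        fun z => u (x + z) - kelvin m (fun z => u (x + z)) l z with hw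
      have hwC : ∀ y : EuclideanSpace ℝ (Fin (m + 2)), y ≠ 0 → ‖y‖ ≤ R →
          ContDiffAt ℝ 2 (fun y => w (-x + y)) y := fun y hy hyR => by
        have h1 : ContDiffAt ℝ 2 w (-x + y) :=
          (hu.contDiffAt_translate (by simpa using hy)).sub
            (hu.contDiffAt_kelvin (norm_pos_iff.1 (hl.trans (hout y hyR)))
              (by nlinarith [hout y hyR]))
        exact ContDiffAt.comp (g := w) y h1 (contDiffAt_const.add contDiffAt_id)
      obtain ⟨c, hc, hcw⟩ := (isCompact_sphere (0 : EuclideanSpace ℝ (Fin (m + 2))) R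
        ).exists_pos_forall_le (f := fun y => w (-x + y))
        (fun y hy => (hwC y (ne_zero_of_mem_sphere hR0.ne' ⟨y, hy⟩) (by simpa using hy.le)
          ).continuousAt.continuousWithinAt)
        (fun y hy => sub_pos.2 (hu.kelvin_lt hl hlx hd (hout y (by simpa using hy.le))
          (by simpa using ne_zero_of_mem_sphere hR0.ne' ⟨y, hy⟩)))
      have hlow : ∀ y : EuclideanSpace ℝ (Fin (m + 2)), y ≠ 0 → ‖y‖ ≤ R → c ≤ w (-x + y) := by
        intro y hy hyR
        refine le_of_superharmonic_punctured hm (w := fun y => w (-x + y)) (R := R)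
          (fun y hy hyR => ⟨hwC y hy hyR, ?_⟩)
          (fun y hy hyR => sub_nonneg.2 (hd _ (hout y hyR).le (by simpa using hy)))
          (fun y hy => hcw y (by simpa using hy)) hy hyR
        rw [eLaplacian_comp_add_left]
        exact hu.lap_sub_kelvin_neg x hx l hl hlx _ (hout y hyR) (by simpa using hy)
          (hd _ (hout y hyR).le (by simpa using hy))
      set k := kelvin m (fun z => u (x + z)) l (-x) with hk
      have hup := hK.eventually (gt_mem_nhds (show k < k + c / 2 by linarith))
      have hK' : ContinuousAt (kelvin m (fun z => u (x + z)) l) (-x) :=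
        (hu.contDiffAt_kelvin hz0 (by nlinarith)).continuousAt
      have hdn := hsnd.eventually (hK'.eventually (lt_mem_nhds (show k - c / 2 < k by linarith)))
      have hnear : ∀ᶠ y in 𝓝 (-x), ‖x + y‖ < R := by
        have : ContinuousAt (fun y => ‖x + y‖) (-x) := by fun_prop
        exact this.eventually (gt_mem_nhds (by simpa using hR0))
      filter_upwards [hup, hdn, hsnd.eventually hnear] with p h1 h2 h3 _ h5
      have h6 := hlow (x + p.2) h5 h3.le
      simp only [hw, neg_add_cancel_left] at h6
      linarith
    · have hf : ContinuousAt (fun p : ℝ × EuclideanSpace ℝ (Fin (m + 2)) => u (x + p.2)) (l, z₀) :=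
        ContinuousAt.comp (g := fun z => u (x + z)) (hu.contDiffAt_translate hxz).continuousAt
          continuousAt_snd
      filter_upwards [hK.eventually_lt hf (hu.kelvin_lt hl hlx hd hz hxz)] with p hp _ _
      exact hp.le

theorem eventually_kelvin_le_at_infinity (hm : 1 ≤ m) (hu : SphereSuperharmonic m u)
    {x : EuclideanSpace ℝ (Fin (m + 2))} {l : ℝ} (hl : 0 < l) (hlx : l < ‖x‖)
    (hd : DominatesKelvin m u x l) :
    ∃ R, ∀ᶠ l' in 𝓝 l, ∀ z, R ≤ ‖z‖ → kelvin m (fun z => u (x + z)) l' z ≤ u (x + z) := by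
  have hx : x ≠ 0 := norm_pos_iff.1 (hl.trans hlx)
  set R := 2 * ‖x‖ with hR
  have hxR : ‖x‖ < R := by linarith
  have hR0 : 0 < R := by linarith
  have hne : ∀ z : EuclideanSpace ℝ (Fin (m + 2)), R ≤ ‖z‖ → x + z ≠ 0 := fun z hz h0 => by
    have := congrArg norm (eq_neg_of_add_eq_zero_left h0)
    rw [norm_neg] at this
    linarith
  set w : EuclideanSpace ℝ (Fin (m + 2)) → ℝ :=
    fun z => u (x + z) - kelvin m (fun z => u (x + z)) l z with hw
  have hwC : ∀ z, R ≤ ‖z‖ → ContDiffAt ℝ 2 w z := fun z hz =>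
    (hu.contDiffAt_translate (hne z hz)).sub
      (hu.contDiffAt_kelvin (norm_pos_iff.1 (hR0.trans_le hz)) (by nlinarith))
  obtain ⟨c, hc, hcw⟩ := (isCompact_sphere (0 : EuclideanSpace ℝ (Fin (m + 2))) R
    ).exists_pos_forall_le (f := w)
    (fun y hy => (hwC y (by simpa using hy.ge)).continuousAt.continuousWithinAt)
    (fun y hy => by
      have hy' : ‖y‖ = R := by simpa using hy
      exact sub_pos.2 (hu.kelvin_lt hl hlx hd (by linarith) (hne y hy'.ge)))
  have hdecay : ∀ z, R ≤ ‖z‖ → c * (R / ‖z‖) ^ m ≤ w z := fun z hz =>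
    decay_of_superharmonic hm hR0 hc.le
      (fun y hy => ⟨hwC y hy, hu.lap_sub_kelvin_neg x hx l hl hlx y (by linarith) (hne y hy)
        (hd y (by linarith) (hne y hy))⟩)
      (fun y hy => sub_nonneg.2 (hd y (by linarith) (hne y hy)))
      (fun y hy => hcw y (by simpa using hy)) hz
  set H : ℝ × EuclideanSpace ℝ (Fin (m + 2)) → ℝ :=
    fun p => p.1 ^ m * u (x + p.1 ^ 2 • p.2) with hH
  have hHc : ContinuousAt H (l, 0) := by
    have h1 : ContinuousAt u (x + l ^ 2 • (0 : EuclideanSpace ℝ (Fin (m + 2)))) := by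
      simpa using (hu.contDiffAt x hx).continuousAt
    refine (continuousAt_fst.pow m).mul (ContinuousAt.comp (g := u) h1 ?_)
    fun_prop
  set ε := c * R ^ m / 2 with hε
  have hε0 : 0 < ε := by positivity
  have hup := hHc.eventually (gt_mem_nhds (show H (l, 0) < H (l, 0) + ε by linarith))
  have hdn := hHc.eventually (lt_mem_nhds (show H (l, 0) - ε < H (l, 0) by linarith))
  rw [nhds_prod_eq] at hup hdn
  obtain ⟨pa, ha, pb, hb, hab⟩ := eventually_prod_iff.1 (hup.and hdn)
  obtain ⟨δ, hδ, hδb⟩ := Metric.eventually_nhds_iff.1 hb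
  refine ⟨max R (1 / δ + 1), ?_⟩
  filter_upwards [ha] with l' hl' z hz
  have hzR : R ≤ ‖z‖ := (le_max_left _ _).trans hz
  have hz0 : 0 < ‖z‖ := hR0.trans_le hzR
  have hzδ : 1 / δ < ‖z‖ := (lt_add_one _).trans_le ((le_max_right _ _).trans hz)
  have hξ : pb ((1 / ‖z‖ ^ 2) • z) := by
    refine hδb ?_
    rw [dist_zero_right, norm_smul, Real.norm_of_nonneg (by positivity)]
    have : 1 / ‖z‖ ^ 2 * ‖z‖ = 1 / ‖z‖ := by field_simp
    rw [this, one_div_lt hz0 hδ]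
    exact hzδ
  have hKH : ∀ t, kelvin m (fun z => u (x + z)) t z
      = (1 / ‖z‖) ^ m * H (t, (1 / ‖z‖ ^ 2) • z) := fun t => by
    simp only [kelvin, hH, smul_smul, mul_one_div, div_pow, one_pow]
    ring
  have h1 := (hab hl' hξ).1
  have h2 := (hab ha.self_of_nhds hξ).2
  have h3 := hdecay z hzR
  have h4 : c * (R / ‖z‖) ^ m = (1 / ‖z‖) ^ m * (2 * ε) := by
    simp only [hε, div_pow, one_pow]
    ring
  simp only [hw] at h3
  rw [hKH] at h3 ⊢
  have h5 : (1 / ‖z‖) ^ m * H (l', (1 / ‖z‖ ^ 2) • z)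
      ≤ (1 / ‖z‖) ^ m * (H (l, (1 / ‖z‖ ^ 2) • z) + 2 * ε) := by
    gcongr
    linarith
  rw [h4] at h3
  linarith

theorem dominatesKelvin (hm : 1 ≤ m) (hu : SphereSuperharmonic m u)
    {x : EuclideanSpace ℝ (Fin (m + 2))} {l : ℝ} (hl : 0 < l) (hlx : l ≤ ‖x‖) :
    DominatesKelvin m u x l := by
  have hx : x ≠ 0 := norm_pos_iff.1 (hl.trans_le hlx)
  suffices ∀ l, 0 < l → l < ‖x‖ → DominatesKelvin m u x l from
    hu.dominatesKelvin_of_forall_lt hl hlx fun l' h1 h2 => this l' h1 (h2.trans_le hlx)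
  by_contra! hcon
  set S : Set ℝ := {l | 0 < l ∧ l < ‖x‖ ∧ ¬ DominatesKelvin m u x l} with hS
  have hSne : S.Nonempty := hcon
  have hSb : BddBelow S := ⟨0, fun l hl => hl.1.le⟩
  obtain ⟨l₀, hl₀, hstart⟩ := hu.exists_dominatesKelvin_of_lt hm hx
  have hl₀L : l₀ ≤ sInf S := le_csInf hSne fun l hl => by
    by_contra! h
    exact hl.2.2 (hstart l hl.1 h)
  set L := sInf S with hL
  have hL0 : 0 < L := hl₀.trans_le hl₀L
  have hLx : L < ‖x‖ := by
    obtain ⟨l, hl⟩ := hSne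
    exact (csInf_le hSb hl).trans_lt hl.2.1
  have hdL : DominatesKelvin m u x L := by
    refine hu.dominatesKelvin_of_forall_lt hL0 hLx.le fun l' h1 h2 => ?_
    by_contra h
    exact absurd (csInf_le hSb ⟨h1, h2.trans hLx, h⟩) (not_le.2 h2)
  obtain ⟨R, hR⟩ := hu.eventually_kelvin_le_at_infinity hm hL0 hLx hdL
  have hcpt := (isCompact_closedBall (0 : EuclideanSpace ℝ (Fin (m + 2))) R
    ).eventually_forall_of_forall_eventually (x₀ := L)
    (P := fun l' z => l' ≤ ‖z‖ → x + z ≠ 0 → kelvin m (fun z => u (x + z)) l' z ≤ u (x + z))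
    fun z _ => hu.eventually_kelvin_le hm hL0 hLx hdL z
  have hev : ∀ᶠ l' in 𝓝 L, DominatesKelvin m u x l' := by
    filter_upwards [hR, hcpt] with l' h1 h2 z hz hxz
    rcases le_total R ‖z‖ with h | h
    · exact h1 z h
    · exact h2 z (by simpa using h) hz hxz
  obtain ⟨δ, hδ, hball⟩ := Metric.eventually_nhds_iff.1 hev
  obtain ⟨l, hl, hlt⟩ := exists_lt_of_csInf_lt hSne (show sInf S < L + δ by linarith)
  refine hl.2.2 (hball ?_)
  rw [Real.dist_eq, abs_of_nonneg (sub_nonneg.2 (csInf_le hSb hl))]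
  linarith

theorem le_of_norm_eq (hm : 1 ≤ m) (hu : SphereSuperharmonic m u)
    {y y' : EuclideanSpace ℝ (Fin (m + 2))} (hy : y ≠ 0) (hy' : y' ≠ 0) (h : ‖y‖ = ‖y'‖) :
    u y' ≤ u y := by
  rcases eq_or_ne y' y with rfl | hne
  · exact le_rfl
  obtain ⟨d, rfl⟩ : ∃ d, y' = y + d := ⟨y' - y, by abel⟩
  have hd : d ≠ 0 := fun hd => hne (by simp [hd])
  have hd' : 0 < ‖d‖ := norm_pos_iff.2 hd
  have hyp : 0 < ‖y‖ := norm_pos_iff.2 hy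
  have hin : 2 * inner ℝ y d = -‖d‖ ^ 2 := by
    have h1 := norm_add_sq_real y d
    rw [← h] at h1
    linarith
  set D : ℝ → ℝ := fun ε => ‖d‖ ^ 2 * (1 + ε) + ε ^ 2 * ‖y‖ ^ 2 with hD
  have hkey : ∀ᶠ ε : ℝ in 𝓝[>] 0, √(‖d‖ ^ 2 / D ε) ^ m *
      u ((‖d‖ ^ 2 / D ε) • y + ((‖d‖ ^ 2 + ε * ‖y‖ ^ 2) / D ε) • d) ≤ u y := by
    filter_upwards [self_mem_nhdsWithin] with ε hε
    have hε : 0 < ε := hε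
    have hDp : 0 < D ε := by positivity
    set x := ε⁻¹ • d with hx
    have hxn : ‖x‖ = ε⁻¹ * ‖d‖ := by
      rw [hx, norm_smul, Real.norm_of_nonneg (by positivity)]
    have hx0 : 0 < ‖x‖ := by rw [hxn]; positivity
    have hzn : ‖y - x‖ ^ 2 = D ε / ε ^ 2 := by
      rw [norm_sub_sq_real, hxn, hx, inner_smul_right, hD]
      have h2 : inner ℝ y d = -‖d‖ ^ 2 / 2 := by linarith
      rw [h2]
      field_simp
      ring
    have hτ : ‖x‖ ^ 2 / ‖y - x‖ ^ 2 = ‖d‖ ^ 2 / D ε := by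
      rw [hzn, hxn]
      field_simp
    have hz : ‖x‖ ≤ ‖y - x‖ := by
      refine le_of_sq_le_sq ?_ (norm_nonneg _)
      rw [hzn, hxn, mul_pow, inv_pow, inv_mul_eq_div]
      gcongr
      rw [hD]
      nlinarith [sq_nonneg (ε * ‖y‖), mul_pos (pow_pos hd' 2) hε]
    have h3 := hu.dominatesKelvin hm hx0 le_rfl (y - x) hz (by simpa using hy)
    rw [kelvin, hτ] at h3
    have h4 : √(‖d‖ ^ 2 / D ε) = ‖x‖ / ‖y - x‖ := by
      rw [← hτ, ← div_pow, Real.sqrt_sq (by positivity)]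
    rw [h4]
    convert h3 using 3
    · have h5 : (1 - ‖d‖ ^ 2 / D ε) * ε⁻¹ = (‖d‖ ^ 2 + ε * ‖y‖ ^ 2) / D ε := by
        field_simp
        rw [hD]
        ring
      rw [← h5, hx]
      module
    · abel
  have hD0 : D 0 = ‖d‖ ^ 2 := by simp [hD]
  have hDc : ContinuousAt D 0 := by fun_prop
  have hDne : D 0 ≠ 0 := by rw [hD0]; positivity
  have hτc : ContinuousAt (fun ε => ‖d‖ ^ 2 / D ε) 0 := continuousAt_const.div hDc hDne
  have hcc : ContinuousAt (fun ε => (‖d‖ ^ 2 + ε * ‖y‖ ^ 2) / D ε) 0 :=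
    ContinuousAt.div (by fun_prop) hDc hDne
  have hpt : (‖d‖ ^ 2 / D 0) • y + ((‖d‖ ^ 2 + 0 * ‖y‖ ^ 2) / D 0) • d = y + d := by
    have h6 : ‖d‖ ^ 2 ≠ 0 := by positivity
    rw [hD0, zero_mul, add_zero, div_self h6, one_smul, one_smul]
  have hF : ContinuousAt (fun ε => √(‖d‖ ^ 2 / D ε) ^ m *
      u ((‖d‖ ^ 2 / D ε) • y + ((‖d‖ ^ 2 + ε * ‖y‖ ^ 2) / D ε) • d)) 0 := by
    refine (hτc.sqrt.pow m).mul (ContinuousAt.comp (g := u) ?_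
      ((hτc.smul continuousAt_const).add (hcc.smul continuousAt_const)))
    exact hpt ▸ (hu.contDiffAt _ hy').continuousAt
  have hlim := le_of_tendsto (hF.tendsto.mono_left nhdsWithin_le_nhds) hkey
  have h6 : ‖d‖ ^ 2 ≠ 0 := by positivity
  rwa [hpt, hD0, div_self h6, Real.sqrt_one, one_pow, one_mul] at hlim

theorem eq_of_norm_eq (hm : 1 ≤ m) (hu : SphereSuperharmonic m u)
    {y y' : EuclideanSpace ℝ (Fin (m + 2))} (hy : y ≠ 0) (hy' : y' ≠ 0) (h : ‖y‖ = ‖y'‖) :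
    u y = u y' :=
  le_antisymm (hu.le_of_norm_eq hm hy' hy h.symm) (hu.le_of_norm_eq hm hy hy' h)

theorem deriv_neg_of_radial (hm : 1 ≤ m) (hu : SphereSuperharmonic m u) {v : ℝ → ℝ}
    (hv : ∀ x, x ≠ 0 → u x = v ‖x‖) {r : ℝ} (hr : 0 < r) : deriv v r < 0 := by
  set e : EuclideanSpace ℝ (Fin (m + 2)) := EuclideanSpace.single 0 1 with he
  have hen : ‖e‖ = 1 := by simp [he]
  have hsn : ∀ s : ℝ, 0 < s → ‖s • e‖ = s := fun s hs => by
    rw [norm_smul, hen, mul_one, Real.norm_of_nonneg hs.le]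
  have hs0 : ∀ s : ℝ, 0 < s → s • e ≠ 0 := fun s hs =>
    norm_pos_iff.1 (by rw [hsn s hs]; exact hs)
  have hvu : ∀ s : ℝ, 0 < s → v s = u (s • e) := fun s hs => by rw [hv _ (hs0 s hs), hsn s hs]
  have hne : ∀ {z : EuclideanSpace ℝ (Fin (m + 2))}, 0 < ‖z‖ → z ≠ 0 := fun h => norm_pos_iff.1 h
  have hdiff : DifferentiableAt ℝ v r := by
    have h1 : DifferentiableAt ℝ (fun s : ℝ => u (s • e)) r :=
      DifferentiableAt.comp (g := u) r ((hu.contDiffAt _ (hs0 r hr)).differentiableAt (by simp))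
        (by fun_prop)
    refine h1.congr_of_eventuallyEq ?_
    filter_upwards [lt_mem_nhds hr] with s hs using hvu s hs
  have hge : ∀ z : EuclideanSpace ℝ (Fin (m + 2)), z ≠ 0 → ‖z‖ ≤ r → v r ≤ u z :=
    fun z hz hzr => le_of_superharmonic_punctured hm
      (fun y hy _ => ⟨hu.contDiffAt y hy, hu.lap_neg y hy⟩) (fun y hy _ => (hu.pos y hy).le)
      (fun y hy => by rw [hv y (hne (hy ▸ hr)), hy]) hz hzr
  set ρ := r / 2 with hρ
  have hρ0 : 0 < ρ := by positivity
  have hρr : ρ < r := by linarith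
  have hgt : v r < v ρ := by
    refine lt_of_le_of_ne (hvu ρ hρ0 ▸ hge _ (hs0 ρ hρ0) ((hsn ρ hρ0).trans_le hρr.le))
      fun heq => ?_
    refine absurd (hu.lap_neg _ (hs0 ρ hρ0)) (not_lt.2
      (eLaplacian_nonneg_of_isLocalMin (hu.contDiffAt _ (hs0 ρ hρ0)) ?_))
    have h1 : ∀ᶠ z : EuclideanSpace ℝ (Fin (m + 2)) in 𝓝 (ρ • e), ‖z‖ < r :=
      continuous_norm.continuousAt.eventually_lt_const ((hsn ρ hρ0).trans_lt hρr)
    filter_upwards [h1, isOpen_ne.mem_nhds (hs0 ρ hρ0)] with z hz hz0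
    rw [← hvu ρ hρ0, ← heq]
    exact hge z hz0 hz.le
  have hpow : (1 / r) ^ m < (1 / ρ) ^ m :=
    pow_lt_pow_left₀ (one_div_lt_one_div_of_lt hρ0 hρr) (by positivity) (by omega)
  set κ := (v ρ - v r) / ((1 / ρ) ^ m - (1 / r) ^ m) with hκ
  have hκ0 : 0 < κ := div_pos (sub_pos.2 hgt) (sub_pos.2 hpow)
  have hκe : κ * ((1 / ρ) ^ m - (1 / r) ^ m) = v ρ - v r :=
    div_mul_cancel₀ _ (sub_pos.2 hpow).ne'
  have hcmp : ∀ z : EuclideanSpace ℝ (Fin (m + 2)), ρ ≤ ‖z‖ → ‖z‖ ≤ r →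
      v r - κ * (1 / r) ^ m + κ * (1 / ‖z‖) ^ m ≤ u z := fun z hz₁ hz₂ =>
    annulus_comparison hρ0
      (fun y hy => (hu.contDiffAt y (hne (hρ0.trans_le hy.1))).continuousAt.continuousWithinAt)
      (fun y hy _ => ⟨hu.contDiffAt y (hne (hρ0.trans hy)), hu.lap_neg y (hne (hρ0.trans hy))⟩)
      (fun y hy => by
        rw [hv y (hne (hy ▸ hρ0)), hy]
        linarith)
      (fun y hy => by
        rw [hv y (hne (hy ▸ hr)), hy]
        linarith) hz₁ hz₂
  have hg : HasDerivAt (fun s : ℝ => v (r * s⁻¹) - κ * (1 / r) ^ m * s ^ m)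
      (deriv v r * -r - κ * (1 / r) ^ m * m) 1 := by
    have h1 : HasDerivAt (fun s : ℝ => r * s⁻¹) (-r) 1 := by
      simpa using (hasDerivAt_inv (one_ne_zero (α := ℝ))).const_mul r
    have h2 : HasDerivAt v (deriv v r) (r * (1 : ℝ)⁻¹) := by simpa using hdiff.hasDerivAt
    have h3 : HasDerivAt (fun s : ℝ => s ^ m) (m : ℝ) 1 := by simpa using hasDerivAt_pow m (1 : ℝ)
    exact (h2.comp 1 h1).sub (h3.const_mul _)
  have hfin := hg.nonneg_of_eventually_le (by
    filter_upwards [Ioo_mem_nhdsGT (one_lt_two (α := ℝ))] with s hs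
    have hs0' : 0 < s := one_pos.trans hs.1
    have hsr : 0 < r * s⁻¹ := by positivity
    have h1 := hcmp ((r * s⁻¹) • e)
      (by
        rw [hsn _ hsr, hρ, div_eq_mul_inv]
        gcongr
        exact hs.2.le)
      (by
        rw [hsn _ hsr]
        exact mul_le_of_le_one_right hr.le (inv_le_one_of_one_le₀ hs.1.le))
    rw [← hvu _ hsr, hsn _ hsr] at h1
    have h2 : (1 / (r * s⁻¹)) ^ m = (1 / r) ^ m * s ^ m := by
      rw [← mul_pow]
      congr 1
      field_simp
    rw [h2] at h1
    simp only [inv_one, mul_one, one_pow]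
    linarith)
  have hpos : 0 < κ * (1 / r) ^ m * m := by
    have : (0 : ℝ) < m := by exact_mod_cast hm
    positivity
  by_contra hcon
  nlinarith [mul_nonneg (not_lt.1 hcon) hr.le]

end SphereSuperharmonic

/-- Positive solutions of `Δu + a u + u ^ ((n + 2) / (n - 2)) = 0` with `n = m + 2`, for a weight
`a` as in the main theorem, satisfy the requirements of the method of moving spheres. -/
theorem sphereSuperharmonic_of_equation {m : ℕ} (hm : 1 ≤ m)
    {a u : EuclideanSpace ℝ (Fin (m + 2)) → ℝ}
    (ha_nonneg : ∀ x, x ≠ 0 → 0 ≤ a x)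
    (ha : ∀ x : EuclideanSpace ℝ (Fin (m + 2)), x ≠ 0 → ∀ l : ℝ, 0 < l → l < ‖x‖ →
      ∀ z : EuclideanSpace ℝ (Fin (m + 2)), l < ‖z‖ → x + z ≠ 0 →
        (l / ‖z‖) ^ 4 * a (x + (l ^ 2 / ‖z‖ ^ 2) • z) < a (x + z))
    (hu : ContDiffOn ℝ 2 u {x | x ≠ 0}) (hpos : ∀ x, x ≠ 0 → 0 < u x)
    (heq : ∀ x, x ≠ 0 → eLaplacian u x + a x * u x + u x ^ (((m : ℝ) + 4) / m) = 0) :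
    SphereSuperharmonic m u where
  contDiffAt x hx := hu.contDiffAt (isOpen_ne.mem_nhds hx)
  pos := hpos
  lap_neg x hx := by
    have h1 := heq x hx
    have h2 := mul_nonneg (ha_nonneg x hx) (hpos x hx).le
    have h3 := Real.rpow_pos_of_pos (hpos x hx) (((m : ℝ) + 4) / m)
    linarith
  lap_sub_kelvin_neg x hx l hl hlx z hlz hxz hle := by
    have hz' : 0 < ‖z‖ := hl.trans hlz
    have hz : z ≠ 0 := norm_pos_iff.1 hz'
    have hq0 : x + (l ^ 2 / ‖z‖ ^ 2) • z ≠ 0 :=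
      add_kelvin_point_ne_zero hz (by rw [sq]; exact mul_lt_mul'' hlx hlz hl.le hl.le)
    have hC : ∀ w, x + w ≠ 0 → ContDiffAt ℝ 2 (fun z => u (x + z)) w := fun w hw =>
      ContDiffAt.comp (g := u) w (hu.contDiffAt (isOpen_ne.mem_nhds hw)) (by fun_prop)
    rw [eLaplacian_sub (hC z hxz) (contDiffAt_kelvin hz (hC _ hq0)),
      eLaplacian_kelvin hz (hC _ hq0), eLaplacian_comp_add_left, eLaplacian_comp_add_left]
    rw [kelvin] at hle
    set q := x + (l ^ 2 / ‖z‖ ^ 2) • z with hq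
    set t := l / ‖z‖ with ht
    have ht0 : 0 < t := by positivity
    have hm0 : (m : ℝ) ≠ 0 := by positivity
    have hK : 0 < t ^ m * u q := mul_pos (pow_pos ht0 m) (hpos q hq0)
    have hp : (t ^ m * u q) ^ (((m : ℝ) + 4) / m) = t ^ (m + 4) * u q ^ (((m : ℝ) + 4) / m) := by
      rw [Real.mul_rpow (by positivity) (hpos q hq0).le, ← Real.rpow_natCast t m,
        ← Real.rpow_mul ht0.le, mul_div_cancel₀ _ hm0, ← Real.rpow_natCast t (m + 4)]
      push_cast
      rfl
    have h1 := heq _ hxz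
    have h2 := heq _ hq0
    have h3 : (t ^ m * u q) ^ (((m : ℝ) + 4) / m) ≤ u (x + z) ^ (((m : ℝ) + 4) / m) :=
      Real.rpow_le_rpow hK.le hle (by positivity)
    have h4 : t ^ 4 * a q * (t ^ m * u q) < a (x + z) * u (x + z) :=
      (mul_lt_mul_of_pos_right (ha x hx l hl hlx z hlz hxz) hK).trans_le
        (mul_le_mul_of_nonneg_left hle (ha_nonneg _ hxz))
    rw [hp] at h3
    have h5 : t ^ (m + 4) * eLaplacian u q =
        -(t ^ 4 * a q * (t ^ m * u q)) - t ^ (m + 4) * u q ^ (((m : ℝ) + 4) / m) := by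
      rw [show eLaplacian u q = -(a q * u q) - u q ^ (((m : ℝ) + 4) / m) by linarith, pow_add]
      ring
    rw [h5]
    linarith

end SphereInversion

theorem stmt5 (n : ℕ) (hn : 3 ≤ n) (a : EuclideanSpace ℝ (Fin n) → ℝ)
    (ha_cont : ContinuousOn a {x | x ≠ 0})
    (ha_nonneg : ∀ x : EuclideanSpace ℝ (Fin n), x ≠ 0 → 0 ≤ a x)
    (ha : ∀ x : EuclideanSpace ℝ (Fin n), x ≠ 0 →
      ∀ lam : ℝ, 0 < lam → lam < ‖x‖ →
      ∀ z : EuclideanSpace ℝ (Fin n), lam < ‖z‖ → x + z ≠ 0 →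
        (lam / ‖z‖) ^ 4 * a (x + (lam ^ 2 / ‖z‖ ^ 2) • z) < a (x + z))
    (u : EuclideanSpace ℝ (Fin n) → ℝ)
    (hu : ContDiffOn ℝ 2 u {x | x ≠ 0})
    (hpos : ∀ x : EuclideanSpace ℝ (Fin n), x ≠ 0 → 0 < u x)
    (heq : ∀ x : EuclideanSpace ℝ (Fin n), x ≠ 0 →
      eLaplacian u x + a x * u x + u x ^ (((n : ℝ) + 2) / ((n : ℝ) - 2)) = 0) :
    (∀ x y : EuclideanSpace ℝ (Fin n), x ≠ 0 → y ≠ 0 → ‖x‖ = ‖y‖ → u x = u y) ∧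
    (∃ ubar : ℝ → ℝ,
      (∀ x : EuclideanSpace ℝ (Fin n), x ≠ 0 → u x = ubar ‖x‖) ∧
      (∀ r : ℝ, 0 < r → deriv ubar r < 0)) := by
  obtain ⟨m, rfl⟩ : ∃ m, n = m + 2 := ⟨n - 2, by omega⟩
  have hm : 1 ≤ m := by omega
  have hexp : (((m + 2 : ℕ) : ℝ) + 2) / (((m + 2 : ℕ) : ℝ) - 2) = ((m : ℝ) + 4) / m := by
    push_cast
    ring
  rw [hexp] at heq
  have hS : SphereSuperharmonic m u :=
    sphereSuperharmonic_of_equation hm ha_nonneg ha hu hpos heq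
  have hsym : ∀ x y : EuclideanSpace ℝ (Fin (m + 2)), x ≠ 0 → y ≠ 0 → ‖x‖ = ‖y‖ → u x = u y :=
    fun x y hx hy h => hS.eq_of_norm_eq hm hx hy h
  have hrad : ∀ x : EuclideanSpace ℝ (Fin (m + 2)), x ≠ 0 →
      u x = u (‖x‖ • EuclideanSpace.single 0 1) := fun x hx =>
    hsym _ _ hx (smul_ne_zero (norm_ne_zero_iff.2 hx) (by simp)) (by simp [norm_smul])
  exact ⟨hsym, fun s => u (s • EuclideanSpace.single 0 1), hrad,
    fun r hr => hS.deriv_neg_of_radial hm hrad hr⟩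
end

section
/- Let n ≥ 3 and let 𝒪 be an open subset of ℝⁿ \ B₁(0), where B₁(0) is the open unit ball. Let b₁, …, bₙ and c be bounded functions on 𝒪. Suppose v ∈ C²(𝒪) ∩ C⁰(closure of 𝒪) satisfies v > 0 on 𝒪 and −Δv(y) + Σᵢ (bᵢ(y)/|y|³) ∂ᵢv(y) + (c(y)/|y|⁴) v(y) ≥ 0 for all y ∈ 𝒪; suppose further that there is a constant c₀ > 0 with v(y) ≥ c₀ |y|^{2−n} for all y ∈ ∂𝒪, and that liminf_{|y| → ∞, y ∈ 𝒪} v(y) ≥ 0. Then there exists a constant c₁ > 0 such that v(y) ≥ c₁ |y|^{2−n} for all y ∈ 𝒪. -/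
open scoped BigOperators

open Filter Topology

/-- A necessary second-order condition for a local minimum of a function on the real line. -/
theorem nonneg_of_isLocalMin_of_hasDerivAt {h h' : ℝ → ℝ} {a t₀ : ℝ}
    (hd : ∀ᶠ t in 𝓝 t₀, HasDerivAt h (h' t) t) (hd' : HasDerivAt h' a t₀)
    (hmin : IsLocalMin h t₀) : 0 ≤ a := by
  by_contra! ha
  have hderiv : deriv h =ᶠ[𝓝 t₀] h' := hd.mono fun t ht => ht.deriv
  have h2 : deriv (deriv h) t₀ = a := hderiv.deriv_eq.trans hd'.deriv
  have hmax : IsLocalMax h t₀ :=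
    isLocalMax_of_deriv_deriv_neg (h2 ▸ ha) hmin.deriv_eq_zero hd.self_of_nhds.continuousAt
  have hconst : h =ᶠ[𝓝 t₀] fun _ => h t₀ := by
    filter_upwards [hmin, hmax] with t h₁ h₂ using le_antisymm h₂ h₁
  have h0 : deriv (deriv h) t₀ = 0 := by
    have : deriv h =ᶠ[𝓝 t₀] fun _ => 0 := by
      filter_upwards [hconst.deriv] with t ht
      simpa using ht
    simpa using this.deriv_eq
  linarith

section SecondDerivative

variable {E : Type*} [NormedAddCommGroup E] [NormedSpace ℝ E]

theorem ContDiffAt.differentiableAt_fderiv_two {f : E → ℝ} {y : E} (hf : ContDiffAt ℝ 2 f y) :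
    DifferentiableAt ℝ (fderiv ℝ f) y :=
  (hf.fderiv_right (m := 1) (by norm_num)).differentiableAt (by norm_num)

theorem IsLocalMin.iteratedFDeriv_two_nonneg {f : E → ℝ} {y : E} (hf : ContDiffAt ℝ 2 f y)
    (hmin : IsLocalMin f y) (e : E) : 0 ≤ iteratedFDeriv ℝ 2 f y ![e, e] := by
  have hline : ∀ t : ℝ, HasDerivAt (fun t : ℝ => y + t • e) e t := fun t => by
    simpa using ((hasDerivAt_id t).smul_const e).const_add y
  have hy : y + (0 : ℝ) • e = y := by simp
  have htend : Tendsto (fun t : ℝ => y + t • e) (𝓝 0) (𝓝 y) := by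
    simpa only [hy] using (hline 0).continuousAt.tendsto
  have hev : ∀ᶠ x in 𝓝 y, DifferentiableAt ℝ f x :=
    (hf.eventually (by norm_num)).mono fun x hx => hx.differentiableAt (by norm_num)
  have hd : ∀ t : ℝ, DifferentiableAt ℝ f (y + t • e) →
      HasDerivAt (fun t : ℝ => f (y + t • e)) (fderiv ℝ f (y + t • e) e) t := fun t ht =>
    ht.hasFDerivAt.comp_hasDerivAt t (hline t)
  have hd' : HasDerivAt (fun t : ℝ => fderiv ℝ f (y + t • e)) (fderiv ℝ (fderiv ℝ f) y e) 0 := by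
    have h1 : HasFDerivAt (fderiv ℝ f) (fderiv ℝ (fderiv ℝ f) y) (y + (0 : ℝ) • e) := by
      rw [hy]; exact hf.differentiableAt_fderiv_two.hasFDerivAt
    exact h1.comp_hasDerivAt (0 : ℝ) (hline 0)
  rw [iteratedFDeriv_two_apply]
  refine nonneg_of_isLocalMin_of_hasDerivAt (h := fun t : ℝ => f (y + t • e))
    (h' := fun t => fderiv ℝ f (y + t • e) e) (t₀ := 0) ?_ ?_ ?_
  · filter_upwards [htend.eventually hev] with t ht using hd t ht
  · simpa using hd'.clm_apply (hasDerivAt_const (0 : ℝ) e)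
  · have := htend.eventually hmin
    simpa [IsLocalMin, IsMinFilter] using this

end SecondDerivative

variable {n : ℕ}

local notation "𝔼" => EuclideanSpace ℝ (Fin n)

/-- The operator `-Δ f + |y|⁻³ ∑ βᵢ ∂ᵢf + |y|⁻⁴ γ f` evaluated at `y`, with coefficients
`β`, `γ` frozen at that point. -/
noncomputable def inversionOp (β : Fin n → ℝ) (γ : ℝ) (f : 𝔼 → ℝ) (y : 𝔼) : ℝ :=
  -eLaplacian f y
    + ∑ i : Fin n, (β i / ‖y‖ ^ 3) * fderiv ℝ f y (EuclideanSpace.single i 1)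
    + (γ / ‖y‖ ^ 4) * f y

theorem inversionOp_add (β : Fin n → ℝ) (γ : ℝ) {f g : 𝔼 → ℝ} {y : 𝔼}
    (hf : ContDiffAt ℝ 2 f y) (hg : ContDiffAt ℝ 2 g y) :
    inversionOp β γ (f + g) y = inversionOp β γ f y + inversionOp β γ g y := by
  unfold inversionOp eLaplacian
  rw [iteratedFDeriv_add_apply (i := 2) hf hg,
    fderiv_add (hf.differentiableAt (by norm_num)) (hg.differentiableAt (by norm_num))]
  simp only [add_apply, mul_add,
    Finset.sum_add_distrib, Pi.add_apply]
  ring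

theorem inversionOp_const_smul (β : Fin n → ℝ) (γ a : ℝ) {f : 𝔼 → ℝ} {y : 𝔼}
    (hf : ContDiffAt ℝ 2 f y) :
    inversionOp β γ (a • f) y = a * inversionOp β γ f y := by
  unfold inversionOp eLaplacian
  rw [iteratedFDeriv_const_smul_apply hf, fderiv_const_smul (hf.differentiableAt (by norm_num))]
  simp only [smul_apply, smul_eq_mul,
    Pi.smul_apply, mul_left_comm _ a, ← Finset.mul_sum]
  ring

theorem inversionOp_nonpos_of_isLocalMin (β : Fin n → ℝ) (γ : ℝ) {f : 𝔼 → ℝ} {y : 𝔼}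
    (hf : ContDiffAt ℝ 2 f y) (hmin : IsLocalMin f y) (h0 : f y = 0) :
    inversionOp β γ f y ≤ 0 := by
  have : 0 ≤ eLaplacian f y :=
    Finset.sum_nonneg fun i _ => hmin.iteratedFDeriv_two_nonneg hf _
  simp [inversionOp, hmin.fderiv_eq_zero, h0, this]

/-- The radial power `|y|^(2s)`. -/
noncomputable def normSqRpow (s : ℝ) (y : 𝔼) : ℝ := (‖y‖ ^ 2) ^ s

theorem contDiffAt_normSqRpow (s : ℝ) {y : 𝔼} (hy : y ≠ 0) :
    ContDiffAt ℝ 2 (normSqRpow s) y :=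
  (contDiff_norm_sq ℝ).contDiffAt.rpow_const_of_ne (by positivity)

theorem hasFDerivAt_normSqRpow (s : ℝ) {y : 𝔼} (hy : y ≠ 0) :
    HasFDerivAt (normSqRpow s) ((2 * s * normSqRpow (s - 1) y) • innerSL ℝ y) y := by
  have h := (hasStrictFDerivAt_norm_sq y).hasFDerivAt.rpow_const (p := s)
    (Or.inl (by positivity))
  refine h.congr_fderiv ?_
  ext e
  simp [normSqRpow]
  ring

theorem fderiv_normSqRpow_single (s : ℝ) {y : 𝔼} (hy : y ≠ 0) (i : Fin n) :
    fderiv ℝ (normSqRpow s) y (EuclideanSpace.single i 1)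
      = 2 * s * normSqRpow (s - 1) y * y i := by
  rw [(hasFDerivAt_normSqRpow s hy).fderiv]
  simp [EuclideanSpace.inner_single_right]

theorem iteratedFDeriv_normSqRpow_single (s : ℝ) {y : 𝔼} (hy : y ≠ 0) (i : Fin n) :
    iteratedFDeriv ℝ 2 (normSqRpow s) y ![EuclideanSpace.single i 1, EuclideanSpace.single i 1]
      = 2 * s * (2 * (s - 1) * normSqRpow (s - 1 - 1) y * y i ^ 2 + normSqRpow (s - 1) y) := by
  set e : 𝔼 := EuclideanSpace.single i 1 with he
  have h1 : fderiv ℝ (fun x => fderiv ℝ (normSqRpow s) x e) y e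
      = fderiv ℝ (fderiv ℝ (normSqRpow s)) y e e := by
    rw [fderiv_clm_apply (contDiffAt_normSqRpow s hy).differentiableAt_fderiv_two
      (differentiableAt_const e)]
    simp
  have h2 : (fun x : 𝔼 => fderiv ℝ (normSqRpow s) x e)
      =ᶠ[𝓝 y] fun x => (2 * s) * (normSqRpow (s - 1) x * x i) := by
    filter_upwards [isOpen_ne.mem_nhds hy] with x hx
    rw [he, fderiv_normSqRpow_single s hx]
    ring
  have h3 := ((hasFDerivAt_normSqRpow (s - 1) hy).mul
    (EuclideanSpace.proj (𝕜 := ℝ) i).hasFDerivAt).const_mul (2 * s)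
  have h4 : fderiv ℝ (fun x => fderiv ℝ (normSqRpow s) x e) y e = _ :=
    congrArg (fun T : 𝔼 →L[ℝ] ℝ => T e) (h2.fderiv_eq.trans h3.fderiv)
  rw [iteratedFDeriv_two_apply]
  simp only [Matrix.cons_val_zero, Matrix.cons_val_one]
  rw [← h1, h4]
  simp [he, EuclideanSpace.inner_single_right]
  ring

theorem normSqRpow_sub_one (s : ℝ) {y : 𝔼} (hy : y ≠ 0) :
    normSqRpow (s - 1) y = normSqRpow s y / ‖y‖ ^ 2 :=
  Real.rpow_sub_one (by positivity) s

theorem eLaplacian_normSqRpow (s : ℝ) {y : 𝔼} (hy : y ≠ 0) :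
    eLaplacian (normSqRpow s) y = 2 * s * (n + 2 * s - 2) * (normSqRpow s y / ‖y‖ ^ 2) := by
  have hr : ‖y‖ ≠ 0 := norm_ne_zero_iff.2 hy
  unfold eLaplacian
  simp only [iteratedFDeriv_normSqRpow_single s hy, ← Finset.mul_sum, Finset.sum_add_distrib,
    ← EuclideanSpace.real_norm_sq_eq, normSqRpow_sub_one _ hy]
  simp
  field_simp
  ring

theorem inversionOp_normSqRpow (β : Fin n → ℝ) (γ s : ℝ) {y : 𝔼} (hy : y ≠ 0) :
    inversionOp β γ (normSqRpow s) y = normSqRpow s y / ‖y‖ ^ 2 *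
      (-(2 * s * (n + 2 * s - 2)) + (2 * s * (∑ i, β i * y i) / ‖y‖ ^ 3 + γ / ‖y‖ ^ 2)) := by
  have hr : ‖y‖ ≠ 0 := norm_ne_zero_iff.2 hy
  have hsum : ∑ i : Fin n, (β i / ‖y‖ ^ 3) * (2 * s * (normSqRpow s y / ‖y‖ ^ 2) * y i)
      = 2 * s * (normSqRpow s y / ‖y‖ ^ 2) * (∑ i, β i * y i) / ‖y‖ ^ 3 := by
    rw [Finset.mul_sum, Finset.sum_div]
    exact Finset.sum_congr rfl fun i _ => by ring
  unfold inversionOp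
  simp only [eLaplacian_normSqRpow s hy, fderiv_normSqRpow_single s hy, normSqRpow_sub_one s hy,
    hsum]
  field_simp
  ring

theorem abs_lowerOrder_le {β : Fin n → ℝ} {γ M C s : ℝ} {y : 𝔼} (hy : y ≠ 0)
    (hβ : ∑ i, |β i| ≤ M) (hγ : |γ| ≤ C) (hs : |2 * s| ≤ n) :
    |2 * s * (∑ i, β i * y i) / ‖y‖ ^ 3 + γ / ‖y‖ ^ 2| ≤ (n * M + C) / ‖y‖ ^ 2 := by
  have hr : 0 < ‖y‖ := norm_pos_iff.2 hy
  have h1 : |∑ i, β i * y i| ≤ M * ‖y‖ := by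
    refine (Finset.abs_sum_le_sum_abs _ _).trans ?_
    refine le_trans ?_ (mul_le_mul_of_nonneg_right hβ hr.le)
    rw [Finset.sum_mul]
    refine Finset.sum_le_sum fun i _ => ?_
    rw [abs_mul]
    exact mul_le_mul_of_nonneg_left (by simpa using PiLp.norm_apply_le y i) (abs_nonneg _)
  have h2 : |2 * s * (∑ i, β i * y i)| ≤ n * (M * ‖y‖) := by
    rw [abs_mul]
    exact mul_le_mul hs h1 (abs_nonneg _) (Nat.cast_nonneg n)
  refine (abs_add_le _ _).trans ?_
  rw [abs_div, abs_div, abs_of_pos (pow_pos hr 3), abs_of_pos (pow_pos hr 2), add_div]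
  refine add_le_add ?_ (by gcongr)
  calc _ ≤ n * (M * ‖y‖) / ‖y‖ ^ 3 := by gcongr
    _ = n * M / ‖y‖ ^ 2 := by field_simp

/-- The barrier `|y|^(2s) + |y|^(2s - 1/2)`. -/
noncomputable def barrier (s : ℝ) : 𝔼 → ℝ := normSqRpow s + normSqRpow (s - 1 / 4)

theorem contDiffAt_barrier (s : ℝ) {y : 𝔼} (hy : y ≠ 0) : ContDiffAt ℝ 2 (barrier s) y :=
  (contDiffAt_normSqRpow s hy).add (contDiffAt_normSqRpow _ hy)

theorem normSqRpow_pos (s : ℝ) {y : 𝔼} (hy : y ≠ 0) : 0 < normSqRpow s y :=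
  Real.rpow_pos_of_pos (by positivity) s

theorem normSqRpow_mono {s t : ℝ} (hst : s ≤ t) {y : 𝔼} (hy : 1 ≤ ‖y‖) :
    normSqRpow s y ≤ normSqRpow t y :=
  Real.rpow_le_rpow_of_exponent_le (one_le_pow₀ hy) hst

theorem normSqRpow_le_barrier (s : ℝ) {y : 𝔼} (hy : y ≠ 0) : normSqRpow s y ≤ barrier s y :=
  le_add_of_nonneg_right (normSqRpow_pos _ hy).le

theorem barrier_le (s : ℝ) {y : 𝔼} (hy : 1 ≤ ‖y‖) : barrier s y ≤ 2 * normSqRpow s y := by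
  have := normSqRpow_mono (show s - 1 / 4 ≤ s by linarith) hy
  simp only [barrier, Pi.add_apply]
  linarith

/-- When `|y|^(2s)` is harmonic, the operator applied to the barrier has, far from the origin,
the sign of its leading coefficient on `|y|^(2s - 1/2)`. -/
theorem exists_inversionOp_barrier_eq {β : Fin n → ℝ} {γ M C s : ℝ} {y : 𝔼}
    (hβ : ∑ i, |β i| ≤ M) (hγ : |γ| ≤ C) (hs : |2 * s| ≤ n) (hs' : |2 * (s - 1 / 4)| ≤ n)
    (hharm : 2 * s * (n + 2 * s - 2) = 0) (hy1 : 1 ≤ ‖y‖) (hy : 8 * (n * M + C) < ‖y‖) :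
    ∃ A F : ℝ, 0 < A ∧ |F| < 1 / 4 ∧ inversionOp β γ (barrier s) y
      = A * (-(2 * (s - 1 / 4) * (n + 2 * (s - 1 / 4) - 2)) + F) := by
  have hr : 0 < ‖y‖ := by linarith
  have hy0 : y ≠ 0 := norm_pos_iff.1 hr
  set K := n * M + C with hK
  have hsplit : normSqRpow (s - 1 / 4) y = normSqRpow s y * normSqRpow (-(1 / 4)) y := by
    rw [sub_eq_add_neg]; exact Real.rpow_add (by positivity) _ _
  set ρ := normSqRpow (-(1 / 4)) y with hρ
  have hρpos : 0 < ρ := normSqRpow_pos _ hy0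
  have hρr : 1 / ‖y‖ ≤ ρ := by
    have h1 : normSqRpow (-(1 / 2)) y = 1 / ‖y‖ := by
      rw [normSqRpow, Real.rpow_neg (by positivity), ← Real.sqrt_eq_rpow, Real.sqrt_sq hr.le,
        one_div]
    rw [← h1]
    exact normSqRpow_mono (by norm_num) hy1
  have hKr : K / ‖y‖ < 1 / 8 := by rw [div_lt_iff₀ hr]; linarith
  have hK0 : 0 ≤ K := by
    have hM : 0 ≤ M := (Finset.sum_nonneg fun i _ => abs_nonneg _).trans hβ
    have hC : 0 ≤ C := (abs_nonneg _).trans hγ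
    positivity
  have hKr2 : K / ‖y‖ ^ 2 = K / ‖y‖ * (1 / ‖y‖) := by field_simp
  have hE1 := abs_lowerOrder_le hy0 hβ hγ hs
  have hE2 := abs_lowerOrder_le hy0 hβ hγ hs'
  set E1 := 2 * s * (∑ i, β i * y i) / ‖y‖ ^ 3 + γ / ‖y‖ ^ 2
  set E2 := 2 * (s - 1 / 4) * (∑ i, β i * y i) / ‖y‖ ^ 3 + γ / ‖y‖ ^ 2
  have hb1 : |E1 / ρ| < 1 / 8 := by
    rw [abs_div, abs_of_pos hρpos, div_lt_iff₀ hρpos]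
    calc |E1| ≤ K / ‖y‖ * (1 / ‖y‖) := hKr2 ▸ hE1
      _ ≤ K / ‖y‖ * ρ := by gcongr
      _ < 1 / 8 * ρ := by gcongr
  have hb2 : |E2| < 1 / 8 := by
    refine hE2.trans_lt (lt_of_le_of_lt ?_ hKr)
    rw [hKr2]
    exact mul_le_of_le_one_right (by positivity) (by rw [div_le_one hr]; exact hy1)
  refine ⟨normSqRpow s y * ρ / ‖y‖ ^ 2, E1 / ρ + E2, ?_, ?_, ?_⟩
  · have := normSqRpow_pos s hy0
    positivity
  · exact (abs_add_le _ _).trans_lt (by linarith)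
  · rw [barrier, inversionOp_add β γ (contDiffAt_normSqRpow s hy0) (contDiffAt_normSqRpow _ hy0),
      inversionOp_normSqRpow β γ s hy0, inversionOp_normSqRpow β γ _ hy0, hharm, hsplit]
    change _ * (-0 + E1) + _ * (_ + E2) = _
    field_simp
    ring

theorem inversionOp_barrier_zero_pos (hn : 3 ≤ n) {β : Fin n → ℝ} {γ M C : ℝ} {y : 𝔼}
    (hβ : ∑ i, |β i| ≤ M) (hγ : |γ| ≤ C) (hy1 : 1 ≤ ‖y‖) (hy : 8 * (n * M + C) < ‖y‖) :
    0 < inversionOp β γ (barrier 0) y := by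
  have hn' : (3 : ℝ) ≤ n := by exact_mod_cast hn
  obtain ⟨A, F, hA, hF, h⟩ := exists_inversionOp_barrier_eq (s := 0) hβ hγ
    (by simp) (by rw [abs_le]; constructor <;> linarith) (by simp) hy1 hy
  rw [h]
  exact mul_pos hA (by linarith [(abs_lt.1 hF).1])

theorem inversionOp_barrier_neg (hn : 3 ≤ n) {β : Fin n → ℝ} {γ M C : ℝ} {y : 𝔼}
    (hβ : ∑ i, |β i| ≤ M) (hγ : |γ| ≤ C) (hy1 : 1 ≤ ‖y‖) (hy : 8 * (n * M + C) < ‖y‖) :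
    inversionOp β γ (barrier ((2 - n) / 2)) y < 0 := by
  have hn' : (3 : ℝ) ≤ n := by exact_mod_cast hn
  obtain ⟨A, F, hA, hF, h⟩ := exists_inversionOp_barrier_eq (s := (2 - n) / 2) hβ hγ
    (by rw [abs_le]; constructor <;> linarith) (by rw [abs_le]; constructor <;> linarith)
    (by ring) hy1 hy
  rw [h]
  exact mul_neg_of_pos_of_neg hA (by linarith [(abs_lt.1 hF).2])

theorem normSqRpow_two_sub_div_two (y : 𝔼) :
    normSqRpow ((2 - n) / 2) y = ‖y‖ ^ ((2 : ℝ) - n) := by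
  rw [normSqRpow, ← Real.rpow_natCast, ← Real.rpow_mul (norm_nonneg y)]
  congr 1
  push_cast
  ring

theorem normSqRpow_zero (y : 𝔼) : normSqRpow 0 y = 1 := Real.rpow_zero _

/-- Comparison in the part of `O` outside the ball of radius `R`. -/
theorem barrier_le_of_supersolution (hn : 3 ≤ n) {O : Set 𝔼} (hO : IsOpen O)
    {b : Fin n → 𝔼 → ℝ} {c : 𝔼 → ℝ} {M C R : ℝ} (hb : ∀ y ∈ O, ∑ i, |b i y| ≤ M)
    (hc : ∀ y ∈ O, |c y| ≤ C) (hR1 : 1 ≤ R) (hR : 8 * (n * M + C) < R)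
    {v : 𝔼 → ℝ} (hv2 : ContDiffOn ℝ 2 v O) (hv0 : ContinuousOn v (closure O))
    (hsuper : ∀ y ∈ O, 0 ≤ inversionOp (fun i => b i y) (c y) v y)
    {c₁ : ℝ} (hc₁ : 0 < c₁)
    (hfr : ∀ y ∈ frontier O, R ≤ ‖y‖ → c₁ * barrier ((2 - n) / 2) y ≤ v y)
    (hsph : ∀ y ∈ O, ‖y‖ = R → c₁ * barrier ((2 - n) / 2) y ≤ v y)
    (hliminf : ∀ ε : ℝ, 0 < ε → ∃ R : ℝ, ∀ y ∈ O, R ≤ ‖y‖ → -ε ≤ v y) :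
    ∀ y ∈ O, R ≤ ‖y‖ → c₁ * barrier ((2 - n) / 2) y ≤ v y := by
  have hn' : (3 : ℝ) ≤ n := by exact_mod_cast hn
  by_contra! hcon
  obtain ⟨z, hzO, hzR, hz⟩ := hcon
  have hne : ∀ {y : 𝔼}, R ≤ ‖y‖ → y ≠ 0 := fun {y} h => norm_pos_iff.1 (by linarith)
  have hφ : ∀ {y : 𝔼}, R ≤ ‖y‖ → 1 ≤ barrier 0 y := fun {y} h => by
    simpa only [normSqRpow_zero] using normSqRpow_le_barrier 0 (hne h)
  set f : 𝔼 → ℝ := fun y => (v y - c₁ * barrier ((2 - n) / 2) y) / barrier 0 y with hf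
  have hfz : f z < 0 := div_neg_of_neg_of_pos (by linarith) (by linarith [hφ hzR])
  have hf_nonneg : ∀ {y : 𝔼}, R ≤ ‖y‖ → c₁ * barrier ((2 - n) / 2) y ≤ v y → 0 ≤ f y :=
    fun {y} h h' => div_nonneg (by linarith) (by linarith [hφ h])
  obtain ⟨R₁, hR₁⟩ := hliminf (-f z / 4) (by linarith)
  set R₂ := max R₁ (max (‖z‖ + 1) (8 * c₁ / (-f z))) with hR₂
  have hfar : ∀ y ∈ O, R ≤ ‖y‖ → R₂ ≤ ‖y‖ → f z < f y := by
    intro y hyO hyR hy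
    have h1 := hR₁ y hyO ((le_max_left _ _).trans hy)
    have h2 : 8 * c₁ / (-f z) ≤ ‖y‖ :=
      ((le_max_right _ _).trans (le_max_right _ _)).trans hy
    rw [div_le_iff₀ (by linarith)] at h2
    have hr : 0 < ‖y‖ := by linarith
    have h3 : barrier ((2 - n) / 2) y ≤ 2 * (1 / ‖y‖) := by
      refine (barrier_le _ (hR1.trans hyR)).trans ?_
      rw [normSqRpow_two_sub_div_two, one_div, ← Real.rpow_neg_one]
      exact mul_le_mul_of_nonneg_left
        (Real.rpow_le_rpow_of_exponent_le (hR1.trans hyR) (by linarith)) (by norm_num)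
    have h4 : c₁ * barrier ((2 - n) / 2) y ≤ -f z / 4 := by
      refine (mul_le_mul_of_nonneg_left h3 hc₁.le).trans ?_
      rw [show c₁ * (2 * (1 / ‖y‖)) = 2 * c₁ / ‖y‖ by ring, div_le_iff₀ hr]
      linarith
    have h5 := hφ hyR
    change f z < (v y - c₁ * barrier ((2 - n) / 2) y) / barrier 0 y
    rw [lt_div_iff₀ (by linarith)]
    nlinarith
  have hcb : ∀ s : ℝ, ContinuousOn (barrier s : 𝔼 → ℝ) {y | R ≤ ‖y‖} := fun s y hy =>
    (contDiffAt_barrier s (hne hy)).continuousAt.continuousWithinAt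
  set S : Set 𝔼 := (closure O ∩ {y | R ≤ ‖y‖}) ∩ Metric.closedBall 0 R₂ with hS
  have hScpt : IsCompact S := (isCompact_closedBall 0 R₂).inter_left
    (isClosed_closure.inter (isClosed_le continuous_const continuous_norm))
  have hfc : ContinuousOn f S := by
    refine ContinuousOn.div ?_ ((hcb 0).mono fun y hy => hy.1.2) fun y hy => ?_
    · exact (hv0.mono fun y hy => hy.1.1).sub
        (((hcb _).mono fun y hy => hy.1.2).const_smul c₁)
    · linarith [hφ hy.1.2]
  have hzlt : ‖z‖ + 1 ≤ R₂ := (le_max_left _ _).trans (le_max_right _ _)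
  have hzS : z ∈ S := ⟨⟨subset_closure hzO, hzR⟩, by rw [mem_closedBall_zero_iff]; linarith⟩
  obtain ⟨y, hyS, hymin⟩ := hScpt.exists_isMinOn ⟨z, hzS⟩ hfc
  have hyz : f y ≤ f z := hymin hzS
  have hyR : R ≤ ‖y‖ := hyS.1.2
  have hyO : y ∈ O := by
    by_contra hyO
    have := hf_nonneg hyR (hfr y ⟨hyS.1.1, by rwa [hO.interior_eq]⟩ hyR)
    linarith
  have hyR' : R < ‖y‖ := by
    refine hyR.lt_of_ne fun h => ?_
    have := hf_nonneg hyR (hsph y hyO h.symm)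
    linarith
  have hyR₂ : ‖y‖ < R₂ := by
    by_contra! h
    have := hfar y hyO hyR h
    linarith
  set m := f y with hm
  set w : 𝔼 → ℝ := v + ((-c₁) • barrier ((2 - n) / 2) + (-m) • barrier 0) with hw
  have hw0 : w y = 0 := by
    have h5 := hφ hyR
    have : m * barrier 0 y = v y - c₁ * barrier ((2 - n) / 2) y := by
      rw [hm]; exact div_mul_cancel₀ _ (by linarith)
    simp [hw]
    linarith
  have hwmin : IsLocalMin w y := by
    filter_upwards [hO.mem_nhds hyO, (isOpen_lt continuous_const continuous_norm).mem_nhds hyR',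
      (isOpen_lt continuous_norm continuous_const).mem_nhds hyR₂] with x hxO hxR hxR₂
    have hxR : R < ‖x‖ := hxR
    have hxS : x ∈ S := ⟨⟨subset_closure hxO, hxR.le⟩,
      by rw [mem_closedBall_zero_iff]; exact le_of_lt hxR₂⟩
    have h6 : m ≤ (v x - c₁ * barrier ((2 - n) / 2) x) / barrier 0 x := hymin hxS
    rw [le_div_iff₀ (by linarith [hφ hxR.le])] at h6
    rw [hw0]
    simp [hw]
    linarith
  have hvy : ContDiffAt ℝ 2 v y := hv2.contDiffAt (hO.mem_nhds hyO)
  have hB1 : ContDiffAt ℝ 2 (barrier ((2 - n) / 2)) y := contDiffAt_barrier _ (hne hyR)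
  have hB0 : ContDiffAt ℝ 2 (barrier 0) y := contDiffAt_barrier _ (hne hyR)
  have hB1' : ContDiffAt ℝ 2 ((-c₁) • barrier ((2 - n) / 2)) y :=
    contDiffAt_const.smul hB1
  have hB0' : ContDiffAt ℝ 2 ((-m) • barrier 0) y :=
    contDiffAt_const.smul hB0
  have hB : ContDiffAt ℝ 2 ((-c₁) • barrier ((2 - n) / 2) + (-m) • barrier 0) y := hB1'.add hB0'
  have hle : inversionOp (fun i => b i y) (c y) w y ≤ 0 :=
    inversionOp_nonpos_of_isLocalMin _ _ (hvy.add hB) hwmin hw0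
  rw [hw, inversionOp_add _ _ hvy hB, inversionOp_add _ _ hB1' hB0',
    inversionOp_const_smul _ _ _ hB1, inversionOp_const_smul _ _ _ hB0] at hle
  have h7 := inversionOp_barrier_zero_pos hn (hb y hyO) (hc y hyO) (hR1.trans hyR)
    (hR.trans_le hyR)
  have h8 := inversionOp_barrier_neg hn (hb y hyO) (hc y hyO) (hR1.trans hyR)
    (hR.trans_le hyR)
  nlinarith [hsuper y hyO, mul_pos_of_neg_of_neg (neg_lt_zero.2 hc₁) h8,
    mul_pos (show 0 < -m by linarith) h7]

theorem stmt18 (n : ℕ) (hn : 3 ≤ n)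
    (O : Set (EuclideanSpace ℝ (Fin n))) (hO_open : IsOpen O)
    (hO_sub : O ⊆ (Metric.ball (0 : EuclideanSpace ℝ (Fin n)) 1)ᶜ)
    (b : Fin n → EuclideanSpace ℝ (Fin n) → ℝ) (c : EuclideanSpace ℝ (Fin n) → ℝ)
    (hb : ∀ i : Fin n, ∃ M : ℝ, ∀ y ∈ O, |b i y| ≤ M)
    (hc : ∃ M : ℝ, ∀ y ∈ O, |c y| ≤ M)
    (v : EuclideanSpace ℝ (Fin n) → ℝ)
    (hv2 : ContDiffOn ℝ 2 v O) (hv0 : ContinuousOn v (closure O))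
    (hvpos : ∀ y ∈ O, 0 < v y)
    (hineq : ∀ y ∈ O,
      0 ≤ -eLaplacian v y
        + ∑ i : Fin n, (b i y / ‖y‖ ^ 3) * fderiv ℝ v y (EuclideanSpace.single i 1)
        + (c y / ‖y‖ ^ 4) * v y)
    (c₀ : ℝ) (hc₀ : 0 < c₀)
    (hbdry : ∀ y ∈ frontier O, c₀ * ‖y‖ ^ ((2 : ℝ) - (n : ℝ)) ≤ v y)
    (hliminf : ∀ ε : ℝ, 0 < ε → ∃ R : ℝ, ∀ y ∈ O, R ≤ ‖y‖ → -ε ≤ v y) :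
    ∃ c₁ : ℝ, 0 < c₁ ∧ ∀ y ∈ O, c₁ * ‖y‖ ^ ((2 : ℝ) - (n : ℝ)) ≤ v y := by
  have hn' : (3 : ℝ) ≤ n := by exact_mod_cast hn
  choose M hM using hb
  obtain ⟨C, hC⟩ := hc
  have hnorm : ∀ y ∈ closure O, 1 ≤ ‖y‖ := fun y hy => by
    have : y ∈ (Metric.ball (0 : EuclideanSpace ℝ (Fin n)) 1)ᶜ :=
      closure_minimal hO_sub Metric.isOpen_ball.isClosed_compl hy
    simpa using this
  have hpow : ∀ y ∈ closure O, ‖y‖ ^ ((2 : ℝ) - n) ≤ 1 := fun y hy =>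
    Real.rpow_le_one_of_one_le_of_nonpos (hnorm y hy) (by linarith)
  have hpos : ∀ y ∈ closure O, 0 < v y := by
    intro y hy
    by_cases hyO : y ∈ O
    · exact hvpos y hyO
    · have h1 := hnorm y hy
      have h2 := hbdry y ⟨hy, by rwa [hO_open.interior_eq]⟩
      have : 0 < ‖y‖ ^ ((2 : ℝ) - n) := Real.rpow_pos_of_pos (by linarith) _
      exact lt_of_lt_of_le (by positivity) h2
  set R := max 1 (8 * (n * (∑ i, M i) + C) + 1) with hR
  have hRC : 8 * (n * (∑ i, M i) + C) < R := lt_of_lt_of_le (by linarith) (le_max_right _ _)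
  obtain ⟨δ, hδ, hδv⟩ : ∃ δ : ℝ, 0 < δ ∧ ∀ y ∈ closure O, ‖y‖ ≤ R → δ ≤ v y := by
    have hcpt : IsCompact (closure O ∩ Metric.closedBall 0 R) :=
      (isCompact_closedBall 0 R).inter_left isClosed_closure
    obtain ⟨δ, hδ, h⟩ := hcpt.exists_forall_le' (hv0.mono Set.inter_subset_left)
      (a := 0) fun y hy => hpos y hy.1
    exact ⟨δ, hδ, fun y hy hyR => h y ⟨hy, mem_closedBall_zero_iff.2 hyR⟩⟩
  set c₁ := min (c₀ / 2) (δ / 2) with hc₁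
  have hc₁pos : 0 < c₁ := lt_min (by linarith) (by linarith)
  have hc₁c₀ : c₁ ≤ c₀ / 2 := min_le_left _ _
  have hc₁δ : c₁ ≤ δ / 2 := min_le_right _ _
  have hbar : ∀ y ∈ closure O, barrier ((2 - n) / 2) y ≤ 2 * ‖y‖ ^ ((2 : ℝ) - n) := fun y hy => by
    simpa only [normSqRpow_two_sub_div_two] using barrier_le ((2 - n) / 2) (hnorm y hy)
  have hpow0 : ∀ y : EuclideanSpace ℝ (Fin n), 0 ≤ ‖y‖ ^ ((2 : ℝ) - n) := fun y =>
    Real.rpow_nonneg (norm_nonneg y) _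
  have key := barrier_le_of_supersolution hn hO_open (b := b) (c := c)
    (fun y hy => Finset.sum_le_sum fun i _ => hM i y hy) hC (le_max_left _ _) hRC hv2 hv0
    hineq hc₁pos
    (fun y hy _ => by
      have h1 := hbar y hy.1
      have h2 := hbdry y hy
      nlinarith [hpow0 y])
    (fun y hy hyR => by
      have h1 := hbar y (subset_closure hy)
      have h2 := hδv y (subset_closure hy) hyR.le
      nlinarith [hpow y (subset_closure hy)])
    hliminf
  refine ⟨c₁, hc₁pos, fun y hy => ?_⟩
  have hy1 := hnorm y (subset_closure hy)
  rcases le_total ‖y‖ R with h | h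
  · nlinarith [hδv y (subset_closure hy) h, hpow y (subset_closure hy)]
  · refine le_trans (mul_le_mul_of_nonneg_left ?_ hc₁pos.le) (key y hy h)
    rw [← normSqRpow_two_sub_div_two]
    exact normSqRpow_le_barrier _ (norm_pos_iff.1 (by linarith))
end

section
/- Let n ≥ 3, let Ω be a bounded open subset of ℝⁿ, and let p be a point of the closure of Ω. Let b₁, …, bₙ and c be bounded functions on Ω. Suppose v ∈ C²(Ω \ {p}) ∩ C⁰((closure of Ω) \ {p}) satisfies v > 0 on Ω \ {p} and −Δv(y) + |y − p| Σᵢ bᵢ(y) ∂ᵢv(y) + c(y) v(y) ≥ 0 for all y ∈ Ω \ {p}, and that inf_{∂Ω \ {p}} v > 0. Then there exists a constant c₁ > 0 such that v(y) > c₁ for all y ∈ Ω \ {p}. -/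
open scoped BigOperators

open Filter Topology Metric Set

lemma IsLocalMin.deriv_deriv_nonneg {f : ℝ → ℝ} {x : ℝ} (h : IsLocalMin f x)
    (hf : ContinuousAt f x) : 0 ≤ deriv (deriv f) x := by
  by_contra! hneg
  have hmax : IsLocalMax f x := isLocalMax_of_deriv_deriv_neg hneg h.deriv_eq_zero hf
  have hconst : f =ᶠ[𝓝 x] fun _ => f x := by
    filter_upwards [h, hmax] with t h1 h2 using le_antisymm h2 h1
  have h2 : deriv (deriv f) x = 0 := by
    rw [hconst.deriv.deriv_eq]
    simp
  exact hneg.ne h2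

/-- First and second order conditions along a line through a point where `v` touches `h` from
above, up to a constant. -/
lemma IsLocalMin.fderiv_eq_and_le_iteratedFDeriv_two {E : Type*} [NormedAddCommGroup E]
    [NormedSpace ℝ E] {v : E → ℝ} {x e : E} (hv : ContDiffAt ℝ 2 v x) {h h' : ℝ → ℝ} {h'' : ℝ}
    (hh : ∀ᶠ t in 𝓝 (0 : ℝ), HasDerivAt h (h' t) t) (hh' : HasDerivAt h' h'' 0)
    (hmin : IsLocalMin (fun t : ℝ => v (x + t • e) - h t) 0) :
    fderiv ℝ v x e = h' 0 ∧ h'' ≤ iteratedFDeriv ℝ 2 v x ![e, e] := by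
  have hline : ∀ t : ℝ, HasDerivAt (fun t : ℝ => x + t • e) e t := fun t => by
    simpa using ((hasDerivAt_id t).smul_const e).const_add x
  have htend : Tendsto (fun t : ℝ => x + t • e) (𝓝 0) (𝓝 x) := by
    simpa using (hline 0).continuousAt.tendsto
  have hdiff : ∀ᶠ y in 𝓝 x, DifferentiableAt ℝ v y :=
    (hv.eventually (by simp)).mono fun y hy => hy.differentiableAt (by simp)
  have hfirst : ∀ᶠ t in 𝓝 (0 : ℝ), HasDerivAt (fun t : ℝ => v (x + t • e) - h t)
      (fderiv ℝ v (x + t • e) e - h' t) t := by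
    filter_upwards [htend.eventually hdiff, hh] with t ht1 ht2
    exact (ht1.hasFDerivAt.comp_hasDerivAt t (hline t)).sub ht2
  have hderiv : deriv (fun t : ℝ => v (x + t • e) - h t) =ᶠ[𝓝 0]
      fun t => fderiv ℝ v (x + t • e) e - h' t := hfirst.mono fun t ht => ht.deriv
  have hfd : DifferentiableAt ℝ (fderiv ℝ v) x :=
    (hv.fderiv_right (m := 1) (by norm_num)).differentiableAt (by simp)
  have hfd' : HasFDerivAt (fderiv ℝ v) (fderiv ℝ (fderiv ℝ v) x) (x + (0 : ℝ) • e) := by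
    simpa using hfd.hasFDerivAt
  have hsecond : HasDerivAt (fun t : ℝ => fderiv ℝ v (x + t • e) e - h' t)
      (fderiv ℝ (fderiv ℝ v) x e e - h'') 0 := by
    have h1 : HasDerivAt (fun t : ℝ => fderiv ℝ v (x + t • e)) (fderiv ℝ (fderiv ℝ v) x e) 0 :=
      hfd'.comp_hasDerivAt (0 : ℝ) (hline 0)
    have h2 : HasDerivAt (fun t : ℝ => fderiv ℝ v (x + t • e) e) (fderiv ℝ (fderiv ℝ v) x e e) 0 :=
      (ContinuousLinearMap.apply ℝ ℝ e).hasFDerivAt.comp_hasDerivAt (0 : ℝ) h1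
    exact h2.sub hh'
  constructor
  · have h1 := hmin.hasDerivAt_eq_zero hfirst.self_of_nhds
    simp only [zero_smul, add_zero] at h1
    linarith
  · have h1 := hmin.deriv_deriv_nonneg hfirst.self_of_nhds.continuousAt
    rw [hderiv.deriv_eq, hsecond.deriv] at h1
    rw [iteratedFDeriv_two_apply]
    simpa using h1

/-- The comparison function `k ρ² + k r² + (ε / 2) log r²`, as a function of `s = r²`. -/
noncomputable def logBarrier (k ρ ε s : ℝ) : ℝ := k * ρ ^ 2 + k * s + ε / 2 * Real.log s

lemma logBarrier_le {k ρ ε s : ℝ} (hε : 0 ≤ ε) (hs0 : 0 ≤ s) (hs1 : s ≤ 1) :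
    logBarrier k ρ ε s ≤ k * ρ ^ 2 + k * s := by
  have h := mul_nonneg hε (neg_nonneg.2 (Real.log_nonpos hs0 hs1))
  unfold logBarrier
  linarith

lemma exists_logBarrier_neg (k ρ : ℝ) {ε : ℝ} (hε : 0 < ε) {d : ℝ} (hd : 0 < d) :
    ∃ δ, 0 < δ ∧ δ < d ∧ ∀ r, 0 < r → r ≤ δ → logBarrier k ρ ε (r ^ 2) < 0 := by
  have h1 : Tendsto (fun r : ℝ => r ^ 2) (𝓝[>] 0) (𝓝[≠] 0) := by
    refine tendsto_nhdsWithin_iff.2 ⟨?_, ?_⟩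
    · have : Tendsto (fun r : ℝ => r ^ 2) (𝓝 0) (𝓝 (0 ^ 2)) := (continuous_pow 2).tendsto 0
      simpa using this.mono_left nhdsWithin_le_nhds
    · filter_upwards [self_mem_nhdsWithin] with r hr
      exact pow_ne_zero 2 (ne_of_gt hr)
  have h2 : Tendsto (logBarrier k ρ ε) (𝓝[≠] 0) atBot := by
    unfold logBarrier
    refine Tendsto.add_atBot (C := k * ρ ^ 2 + k * 0) ?_
      (Real.tendsto_log_nhdsNE_zero.const_mul_atBot (half_pos hε))
    exact (Continuous.tendsto (by fun_prop) 0).mono_left nhdsWithin_le_nhds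
  have h3 := (h2.comp h1).eventually (eventually_lt_atBot 0)
  obtain ⟨u, hu, hu'⟩ := mem_nhdsGT_iff_exists_Ioo_subset.1 h3
  have hu : 0 < u := hu
  refine ⟨min u d / 2, by positivity, ?_, fun r hr hr' => hu' ⟨hr, ?_⟩⟩
  · have := min_le_right u d
    linarith
  · have := min_le_left u d
    linarith

section Euclidean

variable {n : ℕ}

lemma norm_add_smul_single_sq (z : EuclideanSpace ℝ (Fin n)) (i : Fin n) (t : ℝ) :
    ‖z + t • EuclideanSpace.single i (1 : ℝ)‖ ^ 2 = ‖z‖ ^ 2 + 2 * t * z i + t ^ 2 := by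
  rw [norm_add_sq_real, inner_smul_right, EuclideanSpace.inner_single_right, norm_smul]
  simp
  ring

lemma sum_mul_apply_le {B : ℝ} {β : Fin n → ℝ} (hβ : ∀ i, |β i| ≤ B)
    (z : EuclideanSpace ℝ (Fin n)) : ∑ i, β i * z i ≤ n * B * ‖z‖ := by
  have h : ∀ i ∈ Finset.univ, β i * z i ≤ B * ‖z‖ := fun i _ => by
    have h1 : ‖z i‖ ≤ ‖z‖ := PiLp.norm_apply_le z i
    rw [Real.norm_eq_abs] at h1
    calc β i * z i ≤ |β i * z i| := le_abs_self _
      _ = |β i| * |z i| := abs_mul _ _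
      _ ≤ B * ‖z‖ := mul_le_mul (hβ i) h1 (abs_nonneg _) ((abs_nonneg _).trans (hβ i))
  simpa [mul_assoc] using Finset.sum_le_sum h

/-- At a point where `v` minus the barrier has a local minimum, the gradient of `v` is that of the
barrier and the Laplacian of `v` dominates that of the barrier. -/
lemma IsLocalMin.fderiv_eq_and_le_eLaplacian {v : EuclideanSpace ℝ (Fin n) → ℝ}
    {p y : EuclideanSpace ℝ (Fin n)} (hy : y ≠ p) (hv : ContDiffAt ℝ 2 v y) {k ρ ε : ℝ}
    (hmin : IsLocalMin (fun x => v x - logBarrier k ρ ε (‖x - p‖ ^ 2)) y) :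
    (∀ i, fderiv ℝ v y (EuclideanSpace.single i 1) = (2 * k + ε / ‖y - p‖ ^ 2) * (y - p) i) ∧
      2 * n * k + ε * (n - 2) / ‖y - p‖ ^ 2 ≤ eLaplacian v y := by
  set z := y - p with hz
  have hz0 : ‖z‖ ≠ 0 := norm_ne_zero_iff.2 (sub_ne_zero.2 hy)
  have key : ∀ i : Fin n,
      fderiv ℝ v y (EuclideanSpace.single i 1) = (2 * k + ε / ‖z‖ ^ 2) * z i ∧
      2 * k + ε / ‖z‖ ^ 2 - 2 * ε / ‖z‖ ^ 4 * z i ^ 2 ≤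
        iteratedFDeriv ℝ 2 v y ![EuclideanSpace.single i 1, EuclideanSpace.single i 1] := by
    intro i
    set q : ℝ → ℝ := fun t => ‖z‖ ^ 2 + 2 * t * z i + t ^ 2 with hq
    have hqd : ∀ t, HasDerivAt q (2 * z i + 2 * t) t := fun t => by
      have h := (((hasDerivAt_id t).const_mul 2).mul_const (z i)).const_add (‖z‖ ^ 2) |>.add
        (hasDerivAt_pow 2 t)
      exact h.congr_deriv (by simp)
    have hq0 : q 0 = ‖z‖ ^ 2 := by simp [hq]
    have hqne : ∀ᶠ t in 𝓝 (0 : ℝ), q t ≠ 0 :=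
      (hqd 0).continuousAt.eventually_ne (by rw [hq0]; positivity)
    have hh : ∀ᶠ t in 𝓝 (0 : ℝ), HasDerivAt (fun t => logBarrier k ρ ε (q t))
        (k * (2 * z i + 2 * t) + ε / 2 * ((2 * z i + 2 * t) / q t)) t := by
      filter_upwards [hqne] with t ht
      exact (((hqd t).const_mul k).const_add (k * ρ ^ 2)).add (((hqd t).log ht).const_mul (ε / 2))
    have hlin : HasDerivAt (fun t : ℝ => 2 * z i + 2 * t) 2 0 := by
      simpa using ((hasDerivAt_id (0 : ℝ)).const_mul 2).const_add (2 * z i)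
    have hh' := (hlin.const_mul k).add
      ((hlin.div (hqd 0) hqne.self_of_nhds).const_mul (ε / 2))
    have hline : Tendsto (fun t : ℝ => y + t • EuclideanSpace.single i (1 : ℝ)) (𝓝 0) (𝓝 y) := by
      have : Continuous fun t : ℝ => y + t • EuclideanSpace.single i (1 : ℝ) := by fun_prop
      simpa using this.tendsto 0
    have hmin' : IsLocalMin (fun t : ℝ => v (y + t • EuclideanSpace.single i (1 : ℝ))
        - logBarrier k ρ ε (q t)) 0 := by
      have h := hline.eventually hmin
      filter_upwards [h] with t ht
      have e1 : y + t • EuclideanSpace.single i (1 : ℝ) - p =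
        z + t • EuclideanSpace.single i (1 : ℝ) := by rw [hz]; abel
      rw [e1, norm_add_smul_single_sq] at ht
      simpa [hq] using ht
    obtain ⟨h1, h2⟩ := IsLocalMin.fderiv_eq_and_le_iteratedFDeriv_two hv hh hh' hmin'
    refine ⟨?_, le_trans (le_of_eq ?_) h2⟩
    · rw [h1, hq0]
      field_simp
      ring
    · rw [hq0]
      field_simp
      ring
  refine ⟨fun i => (key i).1, ?_⟩
  have hsum := Finset.sum_le_sum fun i (_ : i ∈ Finset.univ) => (key i).2
  refine le_trans (le_of_eq ?_) hsum
  rw [Finset.sum_sub_distrib, ← Finset.mul_sum, ← EuclideanSpace.real_norm_sq_eq]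
  simp only [Finset.sum_const, Finset.card_univ, Fintype.card_fin, nsmul_eq_mul]
  field_simp
  ring

/-- Strict subsolution property of the barrier on a small ball. -/
lemma logBarrier_strict_subsolution (hn : 3 ≤ n) {B M k ρ ε r : ℝ} (hB : 0 ≤ B) (hM : 0 ≤ M)
    (hk : 0 < k) (hρ : ρ ^ 2 * (n * B + M + 1) = 1) (hε : 0 ≤ ε) (hr : 0 < r) (hrρ : r ≤ ρ) :
    -(2 * n * k + ε * (n - 2) / r ^ 2) + n * B * (2 * k * r ^ 2 + ε)
      + M * logBarrier k ρ ε (r ^ 2) < 0 := by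
  have hn' : (3 : ℝ) ≤ n := by exact_mod_cast hn
  have hr2 : r ^ 2 ≤ ρ ^ 2 := pow_le_pow_left₀ hr.le hrρ 2
  have hnB : 0 ≤ n * B := by positivity
  have hρ1 : ρ ^ 2 ≤ 1 := by nlinarith [sq_nonneg ρ]
  have h1 : M * logBarrier k ρ ε (r ^ 2) ≤ M * (2 * k * ρ ^ 2) := by
    refine mul_le_mul_of_nonneg_left ?_ hM
    have := logBarrier_le (k := k) (ρ := ρ) hε (sq_nonneg r) (hr2.trans hρ1)
    nlinarith
  have h2 : n * B * (2 * k * r ^ 2) ≤ n * B * (2 * k * ρ ^ 2) := by gcongr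
  have h3 : n * B * ε ≤ ε * (n - 2) / r ^ 2 := by
    rw [le_div_iff₀ (by positivity)]
    have h4 : n * B * r ^ 2 ≤ 1 := by nlinarith [sq_nonneg ρ]
    nlinarith
  have h5 : (n * B + M) * (2 * k * ρ ^ 2) ≤ 2 * k := by
    have : (n * B + M) * ρ ^ 2 ≤ 1 := by nlinarith [sq_nonneg ρ]
    nlinarith
  nlinarith

end Euclidean

theorem stmt19 (n : ℕ) (hn : 3 ≤ n)
    (Ω : Set (EuclideanSpace ℝ (Fin n))) (hΩ_open : IsOpen Ω)
    (hΩ_bdd : Bornology.IsBounded Ω)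
    (p : EuclideanSpace ℝ (Fin n)) (hp : p ∈ closure Ω)
    (b : Fin n → EuclideanSpace ℝ (Fin n) → ℝ) (c : EuclideanSpace ℝ (Fin n) → ℝ)
    (hb : ∀ i : Fin n, ∃ M : ℝ, ∀ y ∈ Ω, |b i y| ≤ M)
    (hc : ∃ M : ℝ, ∀ y ∈ Ω, |c y| ≤ M)
    (v : EuclideanSpace ℝ (Fin n) → ℝ)
    (hv2 : ContDiffOn ℝ 2 v (Ω \ {p})) (hv0 : ContinuousOn v (closure Ω \ {p}))
    (hvpos : ∀ y ∈ Ω \ {p}, 0 < v y)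
    (hineq : ∀ y ∈ Ω \ {p},
      0 ≤ -eLaplacian v y
        + ‖y - p‖ * ∑ i : Fin n, b i y * fderiv ℝ v y (EuclideanSpace.single i 1)
        + c y * v y)
    (hbdry : ∃ c₀ : ℝ, 0 < c₀ ∧ ∀ y ∈ frontier Ω, y ≠ p → c₀ ≤ v y) :
    ∃ c₁ : ℝ, 0 < c₁ ∧ ∀ y ∈ Ω \ {p}, c₁ < v y := by
  obtain ⟨c₀, hc₀, hbd⟩ := hbdry
  obtain ⟨M, hM0, hM⟩ : ∃ M : ℝ, 0 ≤ M ∧ ∀ y ∈ Ω, c y ≤ M := by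
    obtain ⟨M, hM⟩ := hc
    exact ⟨max M 0, le_max_right _ _, fun y hy =>
      ((le_abs_self _).trans (hM y hy)).trans (le_max_left _ _)⟩
  obtain ⟨B, hB0, hB⟩ : ∃ B : ℝ, 0 ≤ B ∧ ∀ y ∈ Ω, ∀ i, |b i y| ≤ B := by
    choose N hN using hb
    refine ⟨∑ i, |N i|, Finset.sum_nonneg fun i _ => abs_nonneg _, fun y hy i => ?_⟩
    exact ((hN i y hy).trans (le_abs_self _)).trans
      (Finset.single_le_sum (f := fun i => |N i|) (fun j _ => abs_nonneg _) (Finset.mem_univ i))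
  have hD : 0 < n * B + M + 1 := by positivity
  obtain ⟨ρ, hρ0, hρ⟩ : ∃ ρ : ℝ, 0 < ρ ∧ ρ ^ 2 * (n * B + M + 1) = 1 := by
    refine ⟨√(n * B + M + 1)⁻¹, by positivity, ?_⟩
    rw [Real.sq_sqrt (by positivity), inv_mul_cancel₀ hD.ne']
  have hρ1 : ρ ^ 2 ≤ 1 := by
    have : 0 ≤ n * B + M := by positivity
    nlinarith [sq_nonneg ρ]
  have hclpos : ∀ y ∈ closure Ω, y ≠ p → 0 < v y := fun y hy hyp => by
    by_cases h : y ∈ Ω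
    · exact hvpos y ⟨h, hyp⟩
    · exact hc₀.trans_le (hbd y (by rw [hΩ_open.frontier_eq]; exact ⟨hy, h⟩) hyp)
  have hcpt : IsCompact (closure Ω) := hΩ_bdd.isCompact_closure
  obtain ⟨m, hm0, hmc, hm⟩ : ∃ m : ℝ, 0 < m ∧ m ≤ c₀ ∧
      ∀ y ∈ closure Ω, ρ ≤ ‖y - p‖ → m ≤ v y := by
    have hne : ∀ y : EuclideanSpace ℝ (Fin n), ρ ≤ ‖y - p‖ → y ≠ p := by
      rintro y hy rfl
      simp only [sub_self, norm_zero] at hy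
      linarith
    have hK : IsCompact (closure Ω ∩ {y | ρ ≤ ‖y - p‖}) :=
      hcpt.inter_right (isClosed_le (by fun_prop) (by fun_prop))
    obtain ⟨a, ha, ha'⟩ := hK.exists_forall_le' (f := v) (a := 0)
      (hv0.mono fun y hy => ⟨hy.1, hne y hy.2⟩) fun y hy => hclpos y hy.1 (hne y hy.2)
    exact ⟨min a c₀, lt_min ha hc₀, min_le_right _ _, fun y hy hy' =>
      (min_le_left _ _).trans (ha' y ⟨hy, hy'⟩)⟩
  set k : ℝ := m / (2 * ρ ^ 2) with hk
  have hk0 : 0 < k := by positivity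
  have hkρ : k * ρ ^ 2 = m / 2 := by rw [hk]; field_simp
  have hbar : ∀ ε : ℝ, 0 < ε → ∀ y ∈ Ω \ {p}, ‖y - p‖ < ρ →
      logBarrier k ρ ε (‖y - p‖ ^ 2) ≤ v y := by
    intro ε hε y₀ hy₀ hy₀ρ
    by_contra! hlt
    have hy₀p : 0 < ‖y₀ - p‖ := norm_pos_iff.2 (sub_ne_zero.2 hy₀.2)
    obtain ⟨δ, hδ0, hδr, hδ⟩ := exists_logBarrier_neg k ρ hε hy₀p
    have hwm : ∀ y, ‖y - p‖ ≤ ρ → logBarrier k ρ ε (‖y - p‖ ^ 2) ≤ m := fun y hy => by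
      have h1 : ‖y - p‖ ^ 2 ≤ ρ ^ 2 := pow_le_pow_left₀ (norm_nonneg _) hy 2
      have h2 := logBarrier_le (k := k) (ρ := ρ) hε.le (sq_nonneg _) (h1.trans hρ1)
      nlinarith
    have hne : ∀ y : EuclideanSpace ℝ (Fin n), δ ≤ ‖y - p‖ → y ≠ p := by
      rintro y hy rfl
      simp only [sub_self, norm_zero] at hy
      linarith
    have hK : IsCompact (closure Ω ∩ ({y | δ ≤ ‖y - p‖} ∩ {y | ‖y - p‖ ≤ ρ})) :=
      hcpt.inter_right ((isClosed_le (by fun_prop) (by fun_prop)).inter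
        (isClosed_le (by fun_prop) (by fun_prop)))
    have hcont : ContinuousOn (fun y => v y - logBarrier k ρ ε (‖y - p‖ ^ 2))
        (closure Ω ∩ ({y | δ ≤ ‖y - p‖} ∩ {y | ‖y - p‖ ≤ ρ})) := by
      refine (hv0.mono fun y hy => ⟨hy.1, hne y hy.2.1⟩).sub ?_
      unfold logBarrier
      refine ContinuousOn.add (by fun_prop) (continuousOn_const.mul (ContinuousOn.log (by fun_prop)
        fun y hy => pow_ne_zero 2 (hδ0.trans_le hy.2.1).ne'))
    obtain ⟨y, hy, hymin⟩ := hK.exists_isMinOn ⟨y₀, subset_closure hy₀.1, hδr.le, hy₀ρ.le⟩ hcont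
    have hy_neg : v y < logBarrier k ρ ε (‖y - p‖ ^ 2) := by
      have h : v y - logBarrier k ρ ε (‖y - p‖ ^ 2) ≤ v y₀ - logBarrier k ρ ε (‖y₀ - p‖ ^ 2) :=
        hymin ⟨subset_closure hy₀.1, hδr.le, hy₀ρ.le⟩
      linarith
    obtain ⟨hycl, hyδ, hyρ⟩ := hy
    have hyδ : δ ≤ ‖y - p‖ := hyδ
    have hyρ : ‖y - p‖ ≤ ρ := hyρ
    have hyp : y ≠ p := hne y hyδ
    have hr0 : 0 < ‖y - p‖ := hδ0.trans_le hyδ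
    have hyΩ : y ∈ Ω := by
      by_contra h
      have h1 := hbd y (by rw [hΩ_open.frontier_eq]; exact ⟨hycl, h⟩) hyp
      linarith [hwm y hyρ]
    have hyδ' : δ < ‖y - p‖ := by
      by_contra! h
      linarith [hδ _ hr0 h, hvpos y ⟨hyΩ, hyp⟩]
    have hyρ' : ‖y - p‖ < ρ := by
      by_contra! h
      linarith [hm y hycl h, hwm y hyρ]
    have hloc : IsLocalMin (fun y => v y - logBarrier k ρ ε (‖y - p‖ ^ 2)) y := by
      refine hymin.isLocalMin ?_
      have hc : ContinuousAt (fun y => ‖y - p‖) y := by fun_prop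
      filter_upwards [hΩ_open.mem_nhds hyΩ, hc.eventually (lt_mem_nhds hyδ'),
        hc.eventually (gt_mem_nhds hyρ')] with x h1 h2 h3
      exact ⟨subset_closure h1, h2.le, h3.le⟩
    have hvat : ContDiffAt ℝ 2 v y :=
      hv2.contDiffAt ((hΩ_open.sdiff isClosed_singleton).mem_nhds ⟨hyΩ, hyp⟩)
    obtain ⟨hgrad, hlap⟩ := hloc.fderiv_eq_and_le_eLaplacian hyp hvat
    have hstrict := logBarrier_strict_subsolution hn hB0 hM0 hk0 hρ hε.le hr0 hyρ
    have hin := hineq y ⟨hyΩ, hyp⟩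
    have hdrift : ‖y - p‖ * ∑ i : Fin n, b i y * fderiv ℝ v y (EuclideanSpace.single i 1) ≤
        n * B * (2 * k * ‖y - p‖ ^ 2 + ε) := by
      calc ‖y - p‖ * ∑ i : Fin n, b i y * fderiv ℝ v y (EuclideanSpace.single i 1)
          = ‖y - p‖ * (2 * k + ε / ‖y - p‖ ^ 2) * ∑ i : Fin n, b i y * (y - p) i := by
            rw [Finset.mul_sum, Finset.mul_sum]
            refine Finset.sum_congr rfl fun i _ => ?_
            rw [hgrad i]
            ring
        _ ≤ ‖y - p‖ * (2 * k + ε / ‖y - p‖ ^ 2) * (n * B * ‖y - p‖) := by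
            gcongr
            exact sum_mul_apply_le (hB y hyΩ) (y - p)
        _ = n * B * (2 * k * ‖y - p‖ ^ 2 + ε) := by
            field_simp
    have hzero : c y * v y ≤ M * logBarrier k ρ ε (‖y - p‖ ^ 2) :=
      (mul_le_mul_of_nonneg_right (hM y hyΩ) (hvpos y ⟨hyΩ, hyp⟩).le).trans
        (mul_le_mul_of_nonneg_left hy_neg.le hM0)
    linarith
  refine ⟨m / 4, by positivity, fun y hy => ?_⟩
  rcases le_or_gt ρ ‖y - p‖ with h | h
  · linarith [hm y (subset_closure hy.1) h]
  · have hlim : Tendsto (fun ε : ℝ => logBarrier k ρ ε (‖y - p‖ ^ 2)) (𝓝[>] 0)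
        (𝓝 (logBarrier k ρ 0 (‖y - p‖ ^ 2))) := by
      have hc : Continuous fun ε : ℝ => logBarrier k ρ ε (‖y - p‖ ^ 2) := by
        unfold logBarrier
        fun_prop
      exact (hc.tendsto 0).mono_left nhdsWithin_le_nhds
    have hle : logBarrier k ρ 0 (‖y - p‖ ^ 2) ≤ v y :=
      le_of_tendsto hlim (by
        filter_upwards [self_mem_nhdsWithin] with ε hε using hbar ε hε y hy h)
    have h0 : 0 ≤ k * ‖y - p‖ ^ 2 := by positivity
    simp only [logBarrier, zero_div, zero_mul, add_zero] at hle
    linarith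
end
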